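/- Let V ⊆ A^n be a smooth irreducible algebraic variety. Then deg(TV) = deg(V) holds if and only if V is a linear variety (i.e., an affine linear subspace of A^n). -/

import Mathlib

open MvPolynomial

/-- A subset of affine space is an algebraic set if it is the zero locus of an
ideal of polynomials. -/
def IsAlgebraicSet {K : Type} [Field K] {n : ℕ} (W : Set (Fin n → K)) : Prop :=
  ∃ I : Ideal (MvPolynomial (Fin n) K), W = zeroLocus K I

/-- An irreducible affine variety: an algebraic set whose vanishing ideal is prime. -/
def IsIrreducibleVariety {K : Type} [Field K] {n : ℕ} (W : Set (Fin n → K)) : Prop :=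
  IsAlgebraicSet W ∧ (vanishingIdeal K W).IsPrime

/-- The dimension of an affine algebraic set: the Krull dimension of its coordinate ring. -/
noncomputable def varDim {K : Type} [Field K] {n : ℕ} (W : Set (Fin n → K)) : ℕ :=
  ENat.toNat ((ringKrullDim (MvPolynomial (Fin n) K ⧸ vanishingIdeal K W)).unbotD 0)

/-- The (Zariski) tangent space of `W` at `p`:
all `y` with `∇f(p)·y = 0` for every `f ∈ I(W)`. -/
def tangentSpaceAt {K : Type} [Field K] {n : ℕ} (W : Set (Fin n → K)) (p : Fin n → K) :
    Set (Fin n → K) :=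
  {y | ∀ f ∈ vanishingIdeal K W, ∑ i, eval p (pderiv i f) * y i = 0}

/-- The dimension of the tangent space at a point. -/
noncomputable def tangentDimAt {K : Type} [Field K] {n : ℕ} (W : Set (Fin n → K))
    (p : Fin n → K) : ℕ :=
  Module.finrank K (Submodule.span K (tangentSpaceAt W p))

/-- A point of an (irreducible) variety is a smooth point when the tangent space has
the dimension of the variety. -/
def IsSmoothAt {K : Type} [Field K] {n : ℕ} (W : Set (Fin n → K)) (p : Fin n → K) : Prop :=
  tangentDimAt W p = varDim W

/-- A variety is smooth if it is smooth at each of its points. -/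
def IsSmoothVariety {K : Type} [Field K] {n : ℕ} (W : Set (Fin n → K)) : Prop :=
  ∀ p ∈ W, IsSmoothAt W p

/-- Projection `A^{2n} → A^n` to the first `n` coordinates. -/
def fstProj {K : Type} {n : ℕ} (z : Fin (n + n) → K) : Fin n → K :=
  fun i => z (Fin.castAdd n i)

/-- Projection `A^{2n} → A^n` to the last `n` coordinates. -/
def sndProj {K : Type} {n : ℕ} (z : Fin (n + n) → K) : Fin n → K :=
  fun i => z (Fin.natAdd n i)

/-- The tangent bundle `TW ⊆ A^{2n}`: pairs `(x, y)` with `x ∈ W` and `y ∈ T_x W`. -/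
def tangentBundle {K : Type} [Field K] {n : ℕ} (W : Set (Fin n → K)) :
    Set (Fin (n + n) → K) :=
  {z | fstProj z ∈ W ∧ sndProj z ∈ tangentSpaceAt W (fstProj z)}

/-- Zariski closure of a subset of affine space. -/
def zclosure {K : Type} [Field K] {n : ℕ} (W : Set (Fin n → K)) : Set (Fin n → K) :=
  zeroLocus K (vanishingIdeal K W)

/-- The tangential variety `Tan(W)`: the Zariski closure of `π₂(TW)`. -/
def tangentialVariety {K : Type} [Field K] {n : ℕ} (W : Set (Fin n → K)) :
    Set (Fin n → K) :=
  zclosure (sndProj '' tangentBundle W)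

/-- The geometric degree of an (irreducible) affine algebraic set: the maximal finite
number of points in an intersection with an affine-linear subspace of complementary
dimension. -/
noncomputable def geomDegree {K : Type} [Field K] {n : ℕ} (W : Set (Fin n → K)) : ℕ :=
  sSup {m | ∃ L : AffineSubspace K (Fin n → K),
    Module.finrank K L.direction = n - varDim W ∧
    (W ∩ (L : Set (Fin n → K))).Finite ∧ (W ∩ (L : Set (Fin n → K))).ncard = m}

/-- A linear variety: an affine-linear subspace of affine space. -/
def IsLinearVariety {K : Type} [Field K] {n : ℕ} (W : Set (Fin n → K)) : Prop :=
  ∃ L : AffineSubspace K (Fin n → K), W = (L : Set (Fin n → K))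

/-- A line: an affine-linear subspace of dimension 1. -/
def IsLine {K : Type} [Field K] {n : ℕ} (W : Set (Fin n → K)) : Prop :=
  ∃ L : AffineSubspace K (Fin n → K), W = (L : Set (Fin n → K)) ∧
    Module.finrank K L.direction = 1

open Classical in
/-- `ω(C)`: the number of points in the fiber of `π₂ : TC → Tan(C)` over a generic
point of `Tan(C)`; it is `0` when `C` is a line. -/
noncomputable def omegaCurve {K : Type} [Field K] {n : ℕ} (C : Set (Fin n → K)) : ℕ :=
  if IsLine C then 0
  else sInf {m | ∃ Z : Set (Fin n → K), IsAlgebraicSet Z ∧ ¬ tangentialVariety C ⊆ Z ∧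
    ∀ v ∈ tangentialVariety C \ Z,
      {z ∈ tangentBundle C | sndProj z = v}.ncard = m}

/-- A smooth irreducible algebraic curve. -/
def IsSmoothCurve {K : Type} [Field K] {n : ℕ} (C : Set (Fin n → K)) : Prop :=
  IsIrreducibleVariety C ∧ varDim C = 1 ∧ IsSmoothVariety C


lemma tb_L1 {K S ι : Type} [Field K] [CommRing S] [Algebra K S] [Fintype ι] {k : ℕ}
    (ht : Algebra.trdeg K S ≤ (k : Cardinal)) (F : ι → S) (hk : k < Fintype.card ι) :
    ∃ P : MvPolynomial ι K, P ≠ 0 ∧ aeval F P = 0 := by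
  by_contra hcon
  push Not at hcon
  have hF : AlgebraicIndependent K F := by
    rw [algebraicIndependent_iff]
    intro p hp
    by_contra h0
    exact hcon p h0 hp
  have := hF.cardinalMk_le_trdeg.trans ht
  rw [Cardinal.mk_fintype] at this
  have := Nat.cast_le.mp this
  omega

lemma tb_L1' {K S ι : Type} [Field K] [CommRing S] [IsDomain S] [Algebra K S] [Fintype ι]
    (ht : Algebra.trdeg K S ≤ (Fintype.card ι : Cardinal)) (h : S) (h0 : h ≠ 0) (F : ι → S) :
    ∃ P : MvPolynomial ι K, P ≠ 0 ∧ h ∣ aeval F P := by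
  obtain ⟨Q, hQ0, hQ⟩ := tb_L1 ht (fun o : Option ι => o.elim h F) (by simp)
  set q := optionEquivLeft K ι Q with hq
  have hq0 : q ≠ 0 := by
    rw [hq]; simpa using hQ0
  have key : ∀ Q : MvPolynomial (Option ι) K, aeval (fun o : Option ι => o.elim h F) Q =
      Polynomial.eval₂ (aeval F : MvPolynomial ι K →ₐ[K] S).toRingHom h (optionEquivLeft K ι Q) := by
    intro Q
    induction Q using MvPolynomial.induction_on with
    | C a => simp [optionEquivLeft_C]
    | add p q hp hq => simp [hp, hq, Polynomial.eval₂_add]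
    | mul_X p i hp =>
      rw [map_mul, map_mul, Polynomial.eval₂_mul, hp]
      cases i <;> simp [optionEquivLeft_X_none, optionEquivLeft_X_some]
  rw [key, ← hq] at hQ
  obtain ⟨r, hr, hnd⟩ := Polynomial.exists_eq_pow_rootMultiplicity_mul_and_not_dvd q hq0 0
  rw [map_zero, sub_zero] at hr hnd
  rw [hr, Polynomial.eval₂_mul, Polynomial.eval₂_pow, Polynomial.eval₂_X] at hQ
  have hr1 := (mul_eq_zero.mp hQ).resolve_left (pow_ne_zero _ h0)
  refine ⟨r.coeff 0, ?_, ?_⟩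
  · intro hc
    exact hnd (Polynomial.X_dvd_iff.mpr hc)
  · rw [← Polynomial.divX_mul_X_add r, Polynomial.eval₂_add, Polynomial.eval₂_mul,
      Polynomial.eval₂_X, Polynomial.eval₂_C] at hr1
    refine ⟨-(Polynomial.eval₂ (aeval F : MvPolynomial ι K →ₐ[K] S).toRingHom h r.divX), ?_⟩
    have : (aeval F : MvPolynomial ι K →ₐ[K] S).toRingHom (r.coeff 0) = aeval F (r.coeff 0) := rfl
    rw [this] at hr1
    linear_combination hr1


lemma tb_maxheight {K : Type} [Field K] : ∀ (s : ℕ) (m : Ideal (MvPolynomial (Fin s) K)),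
    m.IsMaximal → m.height = s := by
  intro s
  induction s with
  | zero =>
    intro m hm
    have h1 := Ideal.height_le_ringKrullDim_of_ne_top hm.ne_top
    rw [MvPolynomial.ringKrullDim_of_isNoetherianRing, ringKrullDim_eq_zero_of_field] at h1
    simp at h1
    simp
    exact_mod_cast h1
  | succ s ih =>
    intro m hm
    set e := (finSuccEquiv K s).toRingEquiv
    set P : Ideal (Polynomial (MvPolynomial (Fin s) K)) := m.map e with hP
    have hPm : P.IsMaximal := Ideal.map_isMaximal_of_equiv e
    have h2 : P.height = m.height := by
      rw [hP]
      exact RingEquiv.height_map e m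
    have h3 : (P.comap (Polynomial.C)).IsMaximal :=
      Polynomial.isMaximal_comap_C_of_isJacobsonRing P
    have : P.LiesOver (P.comap (Polynomial.C)) := ⟨rfl⟩
    have h4 := Polynomial.height_eq_height_add_one (P.comap (Polynomial.C)) P
    rw [← h2, h4, ih _ h3]
    simp

lemma tb_dim_le {K A R : Type} [Field K] [CommRing A] [CommRing R] [Algebra A R]
    [Algebra.IsIntegral A R] : ringKrullDim R ≤ ringKrullDim A := by
  refine Order.krullDim_le_of_strictMono (fun p => PrimeSpectrum.comap (algebraMap A R) p) ?_
  intro p q hpq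
  obtain ⟨x, hx, hx'⟩ := SetLike.exists_of_lt ((PrimeSpectrum.asIdeal_lt_asIdeal _ _).mpr hpq)
  exact Ideal.comap_lt_comap_of_integral_mem_sdiff
    ((PrimeSpectrum.asIdeal_le_asIdeal _ _).mpr hpq.le) ⟨hx, hx'⟩
    (Algebra.IsIntegral.isIntegral x)

lemma tb_dimfg {K R : Type} [Field K] [CommRing R] [Nontrivial R] [Algebra K R]
    [Algebra.FiniteType K R] : ∃ (s : ℕ) (g : MvPolynomial (Fin s) K →ₐ[K] R),
      Function.Injective g ∧ g.Finite ∧ ringKrullDim R ≤ s := by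
  obtain ⟨s, g, hg, hf⟩ := exists_finite_inj_algHom_of_fg K R
  refine ⟨s, g, hg, hf, ?_⟩
  let := g.toRingHom.toAlgebra
  have : Algebra.IsIntegral (MvPolynomial (Fin s) K) R := ⟨hf.to_isIntegral⟩
  refine (tb_dim_le (K := K) (A := MvPolynomial (Fin s) K)).trans ?_
  rw [MvPolynomial.ringKrullDim_of_isNoetherianRing, ringKrullDim_eq_zero_of_field]
  simp

lemma tb_L2 (K R : Type) [Field K] [CommRing R] [IsDomain R] [Algebra K R]
    [Algebra.FiniteType K R] : ∃ N : ℕ, Algebra.trdeg K R = N ∧ ringKrullDim R = N ∧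
      ∀ m : Ideal R, m.IsMaximal → (N : ℕ∞) ≤ m.height := by
  obtain ⟨s, g, hg, hf, hd⟩ := tb_dimfg (K := K) (R := R)
  let := g.toRingHom.toAlgebra
  have : Algebra.IsIntegral (MvPolynomial (Fin s) K) R := ⟨hf.to_isIntegral⟩
  have : FaithfulSMul (MvPolynomial (Fin s) K) R :=
    (faithfulSMul_iff_algebraMap_injective _ _).mpr hg
  have : IsScalarTower K (MvPolynomial (Fin s) K) R := IsScalarTower.of_algHom g
  have : IsNoetherianRing R := Algebra.FiniteType.isNoetherianRing K R
  have hmax : ∀ m : Ideal R, m.IsMaximal → (s : ℕ∞) ≤ m.height := by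
    intro m hm
    have hp : (m.under (MvPolynomial (Fin s) K)).IsMaximal :=
      Ideal.isMaximal_comap_of_isIntegral_of_isMaximal m
    have h1 := Ideal.height_eq_height_add_of_liesOver_of_hasGoingDown
      (m.under (MvPolynomial (Fin s) K)) m
    rw [tb_maxheight s _ hp] at h1
    rw [h1]
    exact le_self_add
  refine ⟨s, ?_, le_antisymm hd ?_, hmax⟩
  · have h1 := trdeg_add_eq K (MvPolynomial (Fin s) K) (A := R)
    rw [← h1, MvPolynomial.trdeg_of_isDomain, trdeg_eq_zero]
    simp
  · obtain ⟨m, hm⟩ := Ideal.exists_maximal R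
    refine le_trans ?_ (Ideal.height_le_ringKrullDim_of_ne_top hm.ne_top)
    exact_mod_cast hmax m hm


lemma tb_ev {K R ι : Type} [Field K] [CommRing R] [Algebra K R] (ψ : R →ₐ[K] K) (f : ι → R)
    (Q : MvPolynomial ι K) : ψ (aeval f Q) = eval (fun i => ψ (f i)) Q := by
  rw [← AlgHom.comp_apply, MvPolynomial.comp_aeval, MvPolynomial.aeval_eq_eval]

lemma tb_exists_eval {K ι : Type} [Field K] [Infinite K] (P : MvPolynomial ι K)
    (hP : P ≠ 0) : ∃ w : ι → K, eval w P ≠ 0 := by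
  by_contra h
  push Not at h
  exact hP (MvPolynomial.funext (fun x => by simpa using h x))

lemma tb_pt {K R : Type} [Field K] [IsAlgClosed K] [CommRing R] [Algebra K R]
    [Algebra.FiniteType K R] (m : Ideal R) (hm : m.IsMaximal) :
    ∃ φ : R →ₐ[K] K, RingHom.ker φ = m := by
  let := Ideal.Quotient.field m
  have : Module.Finite K (R ⧸ m) := finite_of_finite_type_of_isJacobsonRing K (R ⧸ m)
  have hb := IsAlgClosed.algebraMap_bijective_of_isIntegral (k := K) (K := R ⧸ m)
  let e : K ≃ₐ[K] (R ⧸ m) := AlgEquiv.ofBijective (Algebra.ofId K (R ⧸ m)) hb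
  refine ⟨e.symm.toAlgHom.comp (Ideal.Quotient.mkₐ K m), ?_⟩
  ext x
  simp [RingHom.mem_ker, Ideal.Quotient.eq_zero_iff_mem]

lemma tb_pt_ne_top {K R : Type} [Field K] [IsAlgClosed K] [CommRing R] [Algebra K R]
    [Algebra.FiniteType K R] (I : Ideal R) (hI : I ≠ ⊤) :
    ∃ φ : R →ₐ[K] K, ∀ x ∈ I, φ x = 0 := by
  obtain ⟨m, hm, hle⟩ := Ideal.exists_le_maximal I hI
  obtain ⟨φ, hφ⟩ := tb_pt (K := K) m hm
  refine ⟨φ, fun x hx => ?_⟩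
  rw [← RingHom.mem_ker, hφ]
  exact hle hx

lemma tb_pt_prime {K R : Type} [Field K] [IsAlgClosed K] [CommRing R] [Algebra K R]
    [Algebra.FiniteType K R] (q : Ideal R) [hq : q.IsPrime] (x : R) (hx : x ∉ q) :
    ∃ φ : R →ₐ[K] K, (∀ y ∈ q, φ y = 0) ∧ φ x ≠ 0 := by
  have hJ : IsJacobsonRing R := isJacobsonRing_of_finiteType (A := K)
  have h1 := isJacobsonRing_iff_prime_eq.mp hJ q hq
  rw [← h1, Ideal.jacobson, Submodule.mem_sInf] at hx
  push Not at hx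
  obtain ⟨m, ⟨hle, hm⟩, hxm⟩ := hx
  obtain ⟨φ, hφ⟩ := tb_pt (K := K) m hm
  refine ⟨φ, fun y hy => ?_, fun h => hxm ?_⟩
  · rw [← RingHom.mem_ker, hφ]
    exact hle hy
  · rw [← RingHom.mem_ker, hφ] at h
    exact h

lemma tb_ker_max {K R : Type} [Field K] [CommRing R] [Algebra K R] (φ : R →ₐ[K] K) :
    (RingHom.ker φ).IsMaximal :=
  RingHom.ker_isMaximal_of_surjective _ (fun c => ⟨algebraMap K R c, by simp⟩)

lemma tb_fin_max {K R : Type} [Field K] [IsAlgClosed K] [CommRing R] [Algebra K R]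
    [Algebra.FiniteType K R] (q : Ideal R) [hq : q.IsPrime]
    (hf : {φ : R →ₐ[K] K | ∀ y ∈ q, φ y = 0}.Finite) : q.IsMaximal := by
  have h1 : hf.toFinset.inf (fun φ => RingHom.ker φ) ≤ q := by
    intro x hx
    by_contra hxq
    obtain ⟨φ, h1, h2⟩ := tb_pt_prime (K := K) q x hxq
    rw [Submodule.mem_finsetInf] at hx
    exact h2 (hx φ (by simpa using h1))
  obtain ⟨φ, hφ, hle⟩ := (Ideal.IsPrime.inf_le' hq).mp h1
  have h2 : RingHom.ker φ = q := (tb_ker_max φ).eq_of_le hq.ne_top hle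
  rw [← h2]
  exact tb_ker_max φ

lemma tb_line_prime {K R ι : Type} [Field K] [IsAlgClosed K] [CommRing R] [IsDomain R]
    [Algebra K R] [Algebra.FiniteType K R] [Fintype ι]
    (hN : Algebra.trdeg K R = (Fintype.card ι : Cardinal)) (f : ι → R) (b : ι → K)
    (hfin : {φ : R →ₐ[K] K | ∀ i, φ (f i) = b i}.Finite) (φ : R →ₐ[K] K)
    (hφ : ∀ i, φ (f i) = b i) (u : ι → K) (k : ι) (hk : u k ≠ 0) (s : R)
    (hs : s = algebraMap K R (u k)⁻¹ * (f k - algebraMap K R (b k))) :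
    ∃ q : Ideal R, q.IsPrime ∧ (∀ x ∈ q, φ x = 0) ∧ s ∉ q ∧
      ∀ i, f i - algebraMap K R (b i) - algebraMap K R (u i) * s ∈ q := by
  classical
  have : IsNoetherianRing R := Algebra.FiniteType.isNoetherianRing K R
  obtain ⟨N, hN1, hN2, hN3⟩ := tb_L2 K R
  have hNc : N = Fintype.card ι := by
    rw [hN1] at hN; exact_mod_cast hN
  set S : Finset R := (Finset.univ.erase k).image
    (fun i => f i - algebraMap K R (b i) - algebraMap K R (u i) * s) with hS
  have hs0 : φ s = 0 := by rw [hs]; simp [hφ]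
  have := (tb_ker_max φ).isPrime
  have hle : Ideal.span (S : Set R) ≤ RingHom.ker φ := by
    rw [Ideal.span_le]
    intro x hx
    rw [Finset.mem_coe, hS, Finset.mem_image] at hx
    obtain ⟨i, -, rfl⟩ := hx
    simp [RingHom.mem_ker, hs0, hφ]
  obtain ⟨q, hq, hqle⟩ := Ideal.exists_minimalPrimes_le hle
  have hqp : q.IsPrime := hq.1.1
  have hin : ∀ i, f i - algebraMap K R (b i) - algebraMap K R (u i) * s ∈ q := by
    intro i
    by_cases hik : i = k
    · subst hik
      have : f i - algebraMap K R (b i) - algebraMap K R (u i) * s = 0 := by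
        rw [hs, ← mul_assoc, ← map_mul, mul_inv_cancel₀ hk]; simp
      rw [this]; exact q.zero_mem
    · apply hq.1.2
      apply Ideal.subset_span
      rw [Finset.mem_coe, hS]
      exact Finset.mem_image_of_mem _ (by simp [hik])
  refine ⟨q, hqp, fun x hx => hqle hx, ?_, hin⟩
  intro hsq
  have hmax : q.IsMaximal := by
    apply tb_fin_max (K := K)
    refine hfin.subset ?_
    intro ψ hψ i
    have h1 := hψ _ (hin i)
    have h2 := hψ _ hsq
    simp [h2] at h1
    linear_combination h1
  have h3 := hN3 q hmax
  have h4 : q.height ≤ S.card :=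
    Ideal.height_le_card_of_mem_minimalPrimes_span_finset hq
  have h5 : S.card ≤ Fintype.card ι - 1 := by
    refine Finset.card_image_le.trans ?_
    simp [Finset.card_erase_of_mem]
  have h6 : (N : ℕ∞) ≤ S.card := h3.trans h4
  have h7 : N ≤ S.card := by exact_mod_cast h6
  have h8 : 0 < Fintype.card ι := Fintype.card_pos_iff.mpr ⟨k⟩
  omega

lemma tb_I {K R ι J : Type} [Field K] [IsAlgClosed K] [CommRing R] [IsDomain R]
    [Algebra K R] [Algebra.FiniteType K R] [Fintype ι] [Fintype J] [DecidableEq J]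
    (hN : Algebra.trdeg K R = (Fintype.card ι : Cardinal)) (f : ι → R) (b : ι → K)
    (hfin : {φ : R →ₐ[K] K | ∀ i, φ (f i) = b i}.Finite) (ph : J → (R →ₐ[K] K))
    (hph : ∀ j i, ph j (f i) = b i) (e : J → R)
    (he : ∀ i j, ph i (e j) = if i = j then 1 else 0) (P : J → MvPolynomial ι K)
    (hP : ∑ j, aeval f (P j) * e j = 0) : ∀ j, P j = 0 := by
  by_contra hcon
  push Not at hcon
  obtain ⟨j0, hj0⟩ := hcon
  have hw : ∃ w : ι → K, eval w (P j0) ≠ 0 := by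
    by_contra h
    push Not at h
    exact hj0 (MvPolynomial.funext (fun x => by simpa using h x))
  obtain ⟨w, hw⟩ := hw
  have hev : ∀ (ψ : R →ₐ[K] K) (Q : MvPolynomial ι K), (∀ i, ψ (f i) = b i) →
      ψ (aeval f Q) = eval b Q := by
    intro ψ Q h
    have h2 : (fun i => ψ (f i)) = b := funext h
    rw [← h2, tb_ev]
  by_cases hu : ∃ k, w k - b k ≠ 0
  swap
  · push Not at hu
    have hwb : w = b := by funext k; exact sub_eq_zero.mp (hu k)
    have h1 := congrArg (ph j0) hP
    simp [he, hev _ _ (hph j0)] at h1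
    rw [hwb] at hw
    exact hw h1
  obtain ⟨k, hk⟩ := hu
  obtain ⟨s, hs⟩ : ∃ s, s = algebraMap K R (w k - b k)⁻¹ * (f k - algebraMap K R (b k)) := ⟨_, rfl⟩
  have hq := fun j => tb_line_prime hN f b hfin (ph j) (hph j) (fun i => w i - b i) k hk s hs
  choose q hqp hqker hqs hqin using hq
  set p : J → Polynomial K := fun j =>
    aeval (fun i => Polynomial.C (b i) + Polynomial.C (w i - b i) * Polynomial.X) (P j) with hp
  have hp0 : p j0 ≠ 0 := by
    intro h
    apply hw
    have h1 := congrArg (Polynomial.aeval (1 : K)) h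
    rw [hp, ← AlgHom.comp_apply, MvPolynomial.comp_aeval] at h1
    simpa [MvPolynomial.aeval_eq_eval] using h1
  have hcong : ∀ i j, aeval f (P j) - Polynomial.aeval s (p j) ∈ q i := by
    intro i j
    rw [← Ideal.Quotient.mk_eq_mk_iff_sub_mem]
    have h1 : Ideal.Quotient.mk (q i) (aeval f (P j)) =
      ((Ideal.Quotient.mkₐ K (q i)).comp (aeval f)) (P j) := rfl
    have h2 : Ideal.Quotient.mk (q i) (Polynomial.aeval s (p j)) =
      (((Ideal.Quotient.mkₐ K (q i)).comp (Polynomial.aeval s)).comp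
        (aeval (fun i => Polynomial.C (b i) + Polynomial.C (w i - b i) * Polynomial.X))) (P j) := rfl
    rw [h1, h2]
    congr 1
    ext t
    simp only [AlgHom.comp_apply, aeval_X]
    simp only [Ideal.Quotient.mkₐ_eq_mk]
    rw [Ideal.Quotient.mk_eq_mk_iff_sub_mem]
    have := hqin i t
    simpa [sub_sub] using this
  have hdvd : ∀ m, ∀ j, (Polynomial.X : Polynomial K) ^ m ∣ p j := by
    intro m
    induction m with
    | zero => intro j; simp
    | succ m ih =>
      choose c hc using ih
      intro i
      have h1 : ∑ j, Polynomial.aeval s (p j) * e j ∈ q i := by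
        have h2 : ∑ j, (aeval f (P j) - Polynomial.aeval s (p j)) * e j ∈ q i :=
          Ideal.sum_mem _ fun j _ => Ideal.mul_mem_right _ _ (hcong i j)
        simp only [sub_mul, Finset.sum_sub_distrib, hP, zero_sub] at h2
        exact (neg_mem_iff).mp h2
      have h2 : s ^ m * ∑ j, Polynomial.aeval s (c j) * e j ∈ q i := by
        convert h1 using 1
        rw [Finset.mul_sum]
        refine Finset.sum_congr rfl fun j _ => ?_
        rw [hc j]; simp; ring
      have h3 := ((hqp i).mem_or_mem h2).resolve_left (fun h => hqs i ((hqp i).mem_of_pow_mem _ h))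
      have h4 := hqker i _ h3
      have hs0 : ph i s = 0 := by rw [hs]; simp [hph]
      simp only [map_sum, map_mul, he] at h4
      simp [← Polynomial.aeval_algHom_apply, hs0] at h4
      rw [hc i, pow_succ]
      refine mul_dvd_mul_left _ (Polynomial.X_dvd_iff.mpr ?_)
      simpa [Polynomial.coeff_zero_eq_eval_zero] using h4
  have h1 := Polynomial.natDegree_le_of_dvd (hdvd ((p j0).natDegree + 1) j0) hp0
  simp at h1


lemma tb_F1 {A R : Type} [CommRing A] [IsDomain A] [CommRing R] [IsDomain R]
    [Algebra A R] [FaithfulSMul A R] [Algebra.IsAlgebraic A R] [hft : Algebra.FiniteType A R] :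
    ∃ g : A, g ≠ 0 ∧ ∀ r : R, ∃ k : ℕ, IsIntegral A (algebraMap A R g ^ k * r) := by
  classical
  obtain ⟨s, hs⟩ := hft.out
  have h1 : ∀ r : R, ∃ y : A, y ≠ 0 ∧ IsIntegral A (y • r) := fun r =>
    (Algebra.IsAlgebraic.isAlgebraic r).exists_integral_multiple
  choose y hy0 hy using h1
  refine ⟨∏ r ∈ s, y r, Finset.prod_ne_zero_iff.mpr (fun r _ => hy0 r), fun r => ?_⟩
  have hg : ∀ k : ℕ, IsIntegral A (algebraMap A R (∏ r ∈ s, y r) ^ k) :=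
    fun k => (isIntegral_algebraMap).pow k
  have hr : r ∈ Algebra.adjoin A (s : Set R) := by rw [hs]; trivial
  induction hr using Algebra.adjoin_induction with
  | mem x hx =>
    refine ⟨1, ?_⟩
    rw [pow_one, ← Finset.mul_prod_erase s y hx, mul_comm (y x), map_mul, mul_assoc,
      ← Algebra.smul_def (y x) x]
    exact isIntegral_algebraMap.mul (hy x)
  | algebraMap a => exact ⟨0, by simpa using isIntegral_algebraMap⟩
  | add x z _ _ hx hz =>
    obtain ⟨k, hk⟩ := hx
    obtain ⟨l, hl⟩ := hz
    refine ⟨k + l, ?_⟩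
    rw [mul_add]
    refine IsIntegral.add ?_ ?_
    · rw [pow_add, mul_comm (_ ^ k), mul_assoc]
      exact (hg l).mul hk
    · rw [pow_add, mul_assoc]
      exact (hg k).mul hl
  | mul x z _ _ hx hz =>
    obtain ⟨k, hk⟩ := hx
    obtain ⟨l, hl⟩ := hz
    refine ⟨k + l, ?_⟩
    convert hk.mul hl using 1
    ring

lemma tb_F3 {A R J F E : Type} [CommRing A] [IsDomain A] [CommRing R] [IsDomain R] [Field F]
    [Field E] [Algebra A R] [Algebra A F] [IsFractionRing A F] [Algebra R E] [IsFractionRing R E]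
    [Algebra A E] [Algebra F E] [IsScalarTower A R E] [IsScalarTower A F E]
    [FiniteDimensional F E] [Fintype J] (e : J → R) (he : LinearIndependent A e) :
    Fintype.card J ≤ Module.finrank F E := by
  have h1 : LinearIndependent A (fun j => algebraMap R E (e j)) := by
    have := he.map' (IsScalarTower.toAlgHom A R E).toLinearMap
      (LinearMap.ker_eq_bot.mpr (IsFractionRing.injective R E))
    exact this
  rw [LinearIndependent.iff_fractionRing A F] at h1
  exact h1.fintype_card_le_finrank

lemma tb_F2a {A R F E : Type} [CommRing A] [IsDomain A] [CommRing R] [IsDomain R] [Field F]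
    [Field E] [Algebra A R] [Algebra A F] [IsFractionRing A F] [Algebra R E] [IsFractionRing R E]
    [Algebra A E] [Algebra F E] [IsScalarTower A R E] [IsScalarTower A F E] [CharZero F]
    [FiniteDimensional F E] [Algebra.IsAlgebraic A R] [FaithfulSMul A R] :
    ∃ θ : R, IsIntegral A θ ∧
      (minpoly F (algebraMap R E θ)).natDegree = Module.finrank F E := by
  obtain ⟨α, hα⟩ := Field.exists_primitive_element F E
  obtain ⟨r, s, hs, hrs⟩ := IsFractionRing.div_surjective (A := R) α
  obtain ⟨a, ha0, ⟨t, ht⟩⟩ := (Algebra.IsAlgebraic.isAlgebraic (R := A) s).exists_nonzero_dvd hs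
  obtain ⟨y, hy0, hy⟩ := (Algebra.IsAlgebraic.isAlgebraic (R := A) (t * r)).exists_integral_multiple
  refine ⟨y • (t * r), hy, ?_⟩
  rw [← Field.primitive_element_iff_minpoly_natDegree_eq]
  have hs0 : algebraMap R E s ≠ 0 := by
    intro h
    rw [map_eq_zero_iff _ (IsFractionRing.injective R E)] at h
    exact nonZeroDivisors.ne_zero hs h
  have h1 : algebraMap R E (y • (t * r)) = algebraMap F E (algebraMap A F (y * a)) * α := by
    rw [← IsScalarTower.algebraMap_apply A F E, IsScalarTower.algebraMap_apply A R E, map_mul,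
      map_mul, ht, Algebra.smul_def, ← hrs]
    simp only [map_mul]
    field_simp
  have hne : algebraMap A F (y * a) ≠ 0 := by
    rw [Ne, map_eq_zero_iff _ (IsFractionRing.injective A F)]
    exact mul_ne_zero hy0 ha0
  rw [eq_top_iff, ← hα, IntermediateField.adjoin_simple_le_iff]
  have h2 : α = algebraMap F E (algebraMap A F (y * a))⁻¹ * algebraMap R E (y • (t * r)) := by
    rw [h1, ← mul_assoc, ← map_mul, inv_mul_cancel₀ hne]; simp
  rw [h2]
  exact mul_mem (IntermediateField.algebraMap_mem _ _) (IntermediateField.mem_adjoin_simple_self _ _)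

lemma tb_F2b {A F : Type} [CommRing A] [IsDomain A] [Field F] [Algebra A F] [IsFractionRing A F]
    (μ : Polynomial A) (hμ : (μ.map (algebraMap A F)).Separable) :
    ∃ δ : A, δ ≠ 0 ∧ ∃ u v : Polynomial A,
      u * μ + v * Polynomial.derivative μ = Polynomial.C δ := by
  obtain ⟨u, v, huv⟩ := hμ
  obtain ⟨b, hb, hu⟩ := IsLocalization.integerNormalization_spec (nonZeroDivisors A) u
  obtain ⟨c, hc, hv⟩ := IsLocalization.integerNormalization_spec (nonZeroDivisors A) v
  refine ⟨b * c, mul_ne_zero (nonZeroDivisors.ne_zero hb) (nonZeroDivisors.ne_zero hc),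
    Polynomial.C c * IsLocalization.integerNormalization (nonZeroDivisors A) u,
    Polynomial.C b * IsLocalization.integerNormalization (nonZeroDivisors A) v, ?_⟩
  apply Polynomial.map_injective _ (IsFractionRing.injective A F)
  rw [Polynomial.derivative_map] at huv
  simp only [Polynomial.map_add, Polynomial.map_mul, hu, hv, Polynomial.map_C]
  simp only [Algebra.smul_def, map_mul, Polynomial.algebraMap_apply]
  linear_combination (Polynomial.C (algebraMap A F b) * Polynomial.C (algebraMap A F c)) * huv

lemma tb_F2c {K A R : Type} [Field K] [IsAlgClosed K] [CommRing A] [IsDomain A] [CommRing R]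
    [IsDomain R] [Algebra K A] [Algebra K R] [Algebra A R] [IsScalarTower K A R]
    [FaithfulSMul A R] [IsIntegrallyClosed A] [Algebra.FiniteType K R] (g : A)
    (hg : ∀ r : R, ∃ k : ℕ, IsIntegral A (algebraMap A R g ^ k * r)) (θ : R) (hθ : IsIntegral A θ)
    (β : A →ₐ[K] K) (hβ : β g ≠ 0) (τ : K)
    (hτ : (minpoly A θ).eval₂ (β : A →+* K) τ = 0) :
    ∃ φ : R →ₐ[K] K, (∀ a, φ (algebraMap A R a) = β a) ∧ φ θ = τ := by
  let Cl := integralClosure A R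
  let θ' : Cl := ⟨θ, hθ⟩
  let := (Polynomial.aeval (R := A) θ').toRingHom.toAlgebra
  have hmap : ∀ p : Polynomial A, algebraMap (Polynomial A) Cl p = Polynomial.aeval θ' p :=
    fun p => rfl
  have : IsScalarTower A (Polynomial A) Cl := IsScalarTower.of_algebraMap_eq (fun a => by
    rw [hmap]; simp)
  have : Algebra.IsIntegral (Polynomial A) Cl := Algebra.IsIntegral.tower_top A
  let ψ : Polynomial A →+* K := Polynomial.eval₂RingHom (β : A →+* K) τ
  have hψ : ∀ p, ψ p = p.eval₂ (β : A →+* K) τ := fun p => rfl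
  have : (RingHom.ker ψ).IsPrime := RingHom.ker_isPrime ψ
  obtain ⟨Q, -, hQp, hQ⟩ := Ideal.exists_ideal_over_prime_of_isIntegral (S := Cl)
    (RingHom.ker ψ) ⊥ (by
      intro p hp
      rw [Ideal.mem_comap, hmap, Ideal.mem_bot] at hp
      have hp' : Polynomial.aeval θ p = 0 := by
        have := congrArg (Subalgebra.val Cl) hp
        rw [← Polynomial.aeval_algHom_apply] at this
        exact this.trans (map_zero _)
      obtain ⟨c, hc⟩ := minpoly.isIntegrallyClosed_dvd hθ hp'
      rw [RingHom.mem_ker, hψ, hc, Polynomial.eval₂_mul, hτ, zero_mul])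
  have hQmem : ∀ p : Polynomial A, Polynomial.aeval θ' p ∈ Q ↔ p.eval₂ (β : A →+* K) τ = 0 := by
    intro p
    rw [← hψ, ← RingHom.mem_ker, ← hQ, Ideal.mem_comap, hmap]
  have hQA : ∀ a : A, algebraMap A Cl a ∈ Q ↔ β a = 0 := by
    intro a
    have := hQmem (Polynomial.C a)
    simpa using this
  have hI : Ideal.map (algebraMap Cl R) Q ≠ ⊤ := by
    intro h
    have h1 : ∀ x ∈ Ideal.map (algebraMap Cl R) Q, ∃ (k : ℕ) (z : Cl), z ∈ Q ∧
        algebraMap A R g ^ k * x = z := by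
      intro x hx
      refine Submodule.span_induction ?_ ?_ ?_ ?_ hx
      · rintro _ ⟨z, hz, rfl⟩
        exact ⟨0, z, hz, by simp⟩
      · exact ⟨0, 0, Q.zero_mem, by simp⟩
      · rintro x y - - ⟨k, z, hz, hkz⟩ ⟨l, w, hw, hlw⟩
        refine ⟨k + l, algebraMap A Cl g ^ l * z + algebraMap A Cl g ^ k * w,
          Q.add_mem (Q.mul_mem_left _ hz) (Q.mul_mem_left _ hw), ?_⟩
        push_cast
        rw [← hkz, ← hlw]
        change _ = algebraMap A R g ^ l * _ + algebraMap A R g ^ k * _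
        ring
      · rintro r x - ⟨k, z, hz, hkz⟩
        obtain ⟨l, hl⟩ := hg r
        refine ⟨k + l, ⟨_, hl⟩ * z, Q.mul_mem_left _ hz, ?_⟩
        push_cast
        rw [← hkz, smul_eq_mul]
        ring
    obtain ⟨k, z, hz, hkz⟩ := h1 1 (by rw [h]; trivial)
    have h2 : z = algebraMap A Cl g ^ k := by
      apply Subtype.ext
      rw [← hkz]; push_cast; rw [mul_one]
    rw [h2] at hz
    exact hβ ((hQA g).mp (hQp.mem_of_pow_mem _ hz))
  obtain ⟨φ, hφ⟩ := tb_pt_ne_top (K := K) _ hI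
  have h3 : ∀ z : Cl, z ∈ Q → φ z = 0 := fun z hz => hφ _ (Ideal.mem_map_of_mem (algebraMap Cl R) hz)
  have hconst : ∀ c : K, φ (algebraMap A R (algebraMap K A c)) = c := by
    intro c
    rw [← IsScalarTower.algebraMap_apply]; simp
  refine ⟨φ, fun a => ?_, ?_⟩
  · have h4 := h3 (algebraMap A Cl (a - algebraMap K A (β a))) ((hQA _).mpr (by simp))
    change φ (algebraMap A R (a - algebraMap K A (β a))) = 0 at h4
    rw [map_sub, map_sub, hconst] at h4
    linear_combination h4
  · have h4 := h3 (Polynomial.aeval θ' (Polynomial.X - Polynomial.C (algebraMap K A τ)))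
      ((hQmem _).mpr (by simp))
    have h5 : ((Polynomial.aeval θ' (Polynomial.X - Polynomial.C (algebraMap K A τ)) : Cl) : R)
      = θ - algebraMap A R (algebraMap K A τ) := by
      simp; rfl
    rw [h5, map_sub, hconst] at h4
    linear_combination h4


lemma tb_interp {K R J : Type} [Field K] [CommRing R] [Algebra K R] [Fintype J] [DecidableEq J]
    (ph : J → (R →ₐ[K] K)) (hinj : Function.Injective ph) :
    ∃ e : J → R, ∀ i j, ph i (e j) = if i = j then 1 else 0 := by
  have h1 : ∀ i j, ∃ x : R, i ≠ j → ph j x = 1 ∧ ph i x = 0 := by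
    intro i j
    by_cases hij : i = j
    · exact ⟨0, fun h => absurd hij h⟩
    have h2 : ∃ x, ph j x ≠ ph i x := by
      by_contra h
      push Not at h
      exact hij (hinj (AlgHom.ext h)).symm
    obtain ⟨x, hx⟩ := h2
    have hx' : ph j x - ph i x ≠ 0 := sub_ne_zero.mpr hx
    refine ⟨algebraMap K R (ph j x - ph i x)⁻¹ * (x - algebraMap K R (ph i x)), fun _ => ⟨?_, ?_⟩⟩
    · simp [inv_mul_cancel₀ hx']
    · simp
  choose x hx using h1
  refine ⟨fun j => ∏ i ∈ Finset.univ.erase j, x i j, fun i j => ?_⟩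
  rw [map_prod]
  split_ifs with h
  · subst h
    refine Finset.prod_eq_one fun k hk => (hx k i (Finset.ne_of_mem_erase hk)).1
  · exact Finset.prod_eq_zero (Finset.mem_erase.mpr ⟨h, Finset.mem_univ i⟩) (hx i j h).2

lemma tb_int_root {K R ι : Type} [Field K] [CommRing R] [Algebra K R] (f : ι → R)
    (g : MvPolynomial ι K) (r : R) (k : ℕ)
    (p : Polynomial (MvPolynomial ι K))
    (h0 : p.eval₂ (aeval f : MvPolynomial ι K →ₐ[K] R).toRingHom (aeval f g ^ k * r) = 0)
    (φ : R →ₐ[K] K) (b : ι → K) (hφ : ∀ i, φ (f i) = b i) :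
    (p.map (eval b)).eval (eval b g ^ k * φ r) = 0 := by
  have hb : (fun i => φ (f i)) = b := funext hφ
  have h1 := congrArg φ.toRingHom h0
  rw [Polynomial.hom_eval₂, map_zero] at h1
  have h2 : φ.toRingHom.comp (aeval f : MvPolynomial ι K →ₐ[K] R).toRingHom = eval b := by
    ext x
    · simp
    · simp [hφ]
  rw [h2] at h1
  have h3 : φ.toRingHom (aeval f g ^ k * r) = eval b g ^ k * φ r := by
    change φ (aeval f g ^ k * r) = _
    rw [map_mul, map_pow, tb_ev, hb]
  rw [h3] at h1
  rw [Polynomial.eval_map]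
  exact h1

lemma tb_fib_fin {K R ι : Type} [Field K] [CommRing R] [Algebra K R]
    [hft : Algebra.FiniteType K R] (f : ι → R) (g : MvPolynomial ι K)
    (hg : ∀ r : R, ∃ k : ℕ,
      (aeval f : MvPolynomial ι K →ₐ[K] R).toRingHom.IsIntegralElem (aeval f g ^ k * r))
    (b : ι → K) (hb : eval b g ≠ 0) : {φ : R →ₐ[K] K | ∀ i, φ (f i) = b i}.Finite := by
  classical
  obtain ⟨s, hs⟩ := hft.out
  choose k p hp hp0 using hg
  let Z : s → Set K := fun r => {t | ((p r.1).map (eval b)).eval (eval b g ^ k r.1 * t) = 0}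
  have hZ : ∀ r, (Z r).Finite := by
    intro r
    have hm : ((p r.1).map (eval b)).Monic := (hp r.1).map _
    have h2 : {t : K | ((p r.1).map (eval b)).eval t = 0}.Finite := by
      refine (((p r.1).map (eval b)).roots.toFinset.finite_toSet).subset ?_
      intro t ht
      simp only [Finset.mem_coe, Multiset.mem_toFinset, Polynomial.mem_roots hm.ne_zero]
      exact ht
    refine h2.preimage ?_ |>.subset (fun t ht => ht)
    intro x _ y _ hxy
    exact mul_left_cancel₀ (pow_ne_zero _ hb) hxy
  have hpi : (Set.pi Set.univ Z).Finite := Set.Finite.pi' hZ |>.subset (by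
    intro x hx i; exact hx i (Set.mem_univ i))
  refine Set.Finite.of_finite_image (f := fun φ : R →ₐ[K] K => fun r : s => φ r.1)
    (hpi.subset ?_) ?_
  · rintro _ ⟨φ, hφ, rfl⟩ r -
    exact tb_int_root f g r.1 (k r.1) (p r.1) (hp0 r.1) φ b hφ
  · intro φ _ ψ _ h
    refine AlgHom.ext_of_adjoin_eq_top hs ?_
    intro x hx
    exact congrFun h ⟨x, hx⟩

lemma tb_F {K R ι : Type} [Field K] [IsAlgClosed K] [CharZero K] [CommRing R] [IsDomain R]
    [Algebra K R] [Algebra.FiniteType K R] [Fintype ι]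
    (hN : Algebra.trdeg K R = (Fintype.card ι : Cardinal)) (f : ι → R)
    (hf : AlgebraicIndependent K f) :
    ∃ D : ℕ, 1 ≤ D ∧
      (∀ b : ι → K, {φ : R →ₐ[K] K | ∀ i, φ (f i) = b i}.Finite →
        {φ : R →ₐ[K] K | ∀ i, φ (f i) = b i}.ncard ≤ D) ∧
      ∃ g : MvPolynomial ι K, g ≠ 0 ∧ (∀ r : R, ∃ k : ℕ,
        (aeval f : MvPolynomial ι K →ₐ[K] R).toRingHom.IsIntegralElem (aeval f g ^ k * r)) ∧
      ∃ G : MvPolynomial ι K, G ≠ 0 ∧ ∀ b, eval b G ≠ 0 → eval b g ≠ 0 ∧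
        {φ : R →ₐ[K] K | ∀ i, φ (f i) = b i}.Finite ∧
        {φ : R →ₐ[K] K | ∀ i, φ (f i) = b i}.ncard = D := by
  classical
  let := (aeval f : MvPolynomial ι K →ₐ[K] R).toRingHom.toAlgebra
  have hmap : ∀ a, algebraMap (MvPolynomial ι K) R a = aeval f a := fun _ => rfl
  have : IsScalarTower K (MvPolynomial ι K) R := IsScalarTower.of_algHom (aeval f)
  have : FaithfulSMul (MvPolynomial ι K) R :=
    (faithfulSMul_iff_algebraMap_injective _ _).mpr hf
  have : Algebra.FiniteType (MvPolynomial ι K) R :=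
    Algebra.FiniteType.of_restrictScalars_finiteType K (MvPolynomial ι K) R
  have hbas : IsTranscendenceBasis K f :=
    hf.isTranscendenceBasis_of_trdeg_le_of_finite (by rw [hN, Cardinal.mk_fintype])
  have : Algebra.IsAlgebraic (MvPolynomial ι K) R := by
    rw [← trdeg_eq_zero_iff]
    have h1 := trdeg_add_eq K (MvPolynomial ι K) (A := R)
    rw [hN, MvPolynomial.trdeg_of_isDomain, Cardinal.mk_fintype] at h1
    simp only [Cardinal.lift_natCast] at h1
    have h2 : Algebra.trdeg (MvPolynomial ι K) R < Cardinal.aleph0 := trdeg_lt_aleph0_of_finiteType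
    obtain ⟨m, hm⟩ := Cardinal.lt_aleph0.mp h2
    rw [hm] at h1 ⊢
    have h3 : Fintype.card ι + m = Fintype.card ι := by exact_mod_cast h1
    have : m = 0 := by omega
    simp [this]
  let F := FractionRing (MvPolynomial ι K)
  let E := FractionRing R
  have : FaithfulSMul (MvPolynomial ι K) E := by
    rw [faithfulSMul_iff_algebraMap_injective, IsScalarTower.algebraMap_eq _ R E]
    exact (IsFractionRing.injective R E).comp hf
  let : Algebra F E := FractionRing.liftAlgebra (MvPolynomial ι K) E
  have : IsScalarTower (MvPolynomial ι K) F E := FractionRing.isScalarTower_liftAlgebra _ _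
  have : Algebra.IsAlgebraic F E := by
    have h1 : Algebra.IsAlgebraic (MvPolynomial ι K) E :=
      (IsFractionRing.isAlgebraic_iff' (MvPolynomial ι K) R E).mp inferInstance
    exact (IsFractionRing.comap_isAlgebraic_iff (A := MvPolynomial ι K) (K := F)).mp h1
  have : Algebra.EssFiniteType (MvPolynomial ι K) E := by
    have : Algebra.EssFiniteType R E := .of_isLocalization _ (nonZeroDivisors R)
    exact .comp _ R _
  have : Algebra.EssFiniteType F E := .of_comp (MvPolynomial ι K) F E
  have : FiniteDimensional F E := Algebra.finite_of_essFiniteType_of_isAlgebraic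
  have : CharZero F := by
    have : CharZero (MvPolynomial ι K) := inferInstance
    exact charZero_of_injective_algebraMap (IsFractionRing.injective (MvPolynomial ι K) F)
  have hub : ∀ b : ι → K, {φ : R →ₐ[K] K | ∀ i, φ (f i) = b i}.Finite →
        {φ : R →ₐ[K] K | ∀ i, φ (f i) = b i}.ncard ≤ Module.finrank F E := by
    intro b hb
    have := hb.fintype
    let ph : {φ : R →ₐ[K] K | ∀ i, φ (f i) = b i} → (R →ₐ[K] K) := Subtype.val
    obtain ⟨e, he⟩ := tb_interp ph Subtype.val_injective
    rw [← Nat.card_coe_set_eq, Nat.card_eq_fintype_card]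
    apply tb_F3 (A := MvPolynomial ι K) (E := E) e
    rw [Fintype.linearIndependent_iff]
    intro P hP
    exact tb_I hN f b hb ph (fun j i => j.2 i) e he P (by
      simpa only [Algebra.smul_def, hmap] using hP)
  refine ⟨Module.finrank F E, Module.finrank_pos, hub, ?_⟩
  obtain ⟨g, hg0, hg⟩ := tb_F1 (A := MvPolynomial ι K) (R := R)
  refine ⟨g, hg0, hg, ?_⟩
  obtain ⟨θ, hθ, hdeg⟩ := tb_F2a (A := MvPolynomial ι K) (R := R) (F := F) (E := E)
  have hmin := minpoly.isIntegrallyClosed_eq_field_fractions F E hθ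
  have hsep : ((minpoly (MvPolynomial ι K) θ).map (algebraMap (MvPolynomial ι K) F)).Separable := by
    rw [← hmin]
    exact (Algebra.IsSeparable.isSeparable F (algebraMap R E θ))
  obtain ⟨δ, hδ0, u, v, huv⟩ := tb_F2b _ hsep
  refine ⟨g * δ, mul_ne_zero hg0 hδ0, fun b hb => ?_⟩
  rw [map_mul] at hb
  have hgb := left_ne_zero_of_mul hb
  have hδb := right_ne_zero_of_mul hb
  have hfin := tb_fib_fin f g hg b hgb
  refine ⟨hgb, hfin, le_antisymm (hub b hfin) ?_⟩
  set μ := minpoly (MvPolynomial ι K) θ with hμ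
  have hmon : μ.Monic := minpoly.monic hθ
  have hdeg2 : μ.natDegree = Module.finrank F E := by
    rw [← hdeg, hmin, hmon.natDegree_map]
  set μb := μ.map (eval b) with hμb
  have hsepb : μb.Separable := by
    have h1 := congrArg (Polynomial.map (eval b)) huv
    simp only [Polynomial.map_add, Polynomial.map_mul, Polynomial.map_C] at h1
    rw [← Polynomial.derivative_map] at h1
    refine ⟨Polynomial.C (eval b δ)⁻¹ * u.map (eval b), Polynomial.C (eval b δ)⁻¹ * v.map (eval b), ?_⟩
    have h2 : Polynomial.C (eval b δ)⁻¹ * Polynomial.C (eval b δ) = 1 := by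
      rw [← Polynomial.C_mul, inv_mul_cancel₀ hδb, Polynomial.C_1]
    linear_combination Polynomial.C (eval b δ)⁻¹ * h1 + h2
  have hcard : μb.roots.toFinset.card = Module.finrank F E := by
    rw [Multiset.toFinset_card_of_nodup (Polynomial.nodup_roots hsepb),
      IsAlgClosed.card_roots_eq_natDegree, hμb, hmon.natDegree_map, hdeg2]
  have hex : ∀ τ ∈ μb.roots.toFinset, ∃ φ : R →ₐ[K] K, (∀ i, φ (f i) = b i) ∧ φ θ = τ := by
    intro τ hτ
    rw [Multiset.mem_toFinset, Polynomial.mem_roots (hmon.map _).ne_zero, Polynomial.IsRoot,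
      Polynomial.eval_map] at hτ
    obtain ⟨φ, h1, h2⟩ := tb_F2c (K := K) (A := MvPolynomial ι K) g hg θ hθ (aeval b)
      (by rw [MvPolynomial.aeval_eq_eval]; exact hgb) τ (by
        have hcoe : ((aeval b : MvPolynomial ι K →ₐ[K] K) : MvPolynomial ι K →+* K) = eval b := by
          ext x <;> simp
        rw [hcoe]
        exact hτ)
    refine ⟨φ, fun i => ?_, h2⟩
    have := h1 (X i)
    rw [hmap] at this
    simpa using this
  have : Nonempty (R →ₐ[K] K) := by
    obtain ⟨φ, -⟩ := tb_pt_ne_top (K := K) (⊥ : Ideal R) bot_ne_top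
    exact ⟨φ⟩
  choose! Φ hΦ1 hΦ2 using hex
  rw [← hcard, ← Set.ncard_coe_finset]
  refine Set.ncard_le_ncard_of_injOn Φ (fun τ hτ => hΦ1 τ hτ) ?_ hfin
  intro x hx y hy hxy
  rw [← hΦ2 x hx, ← hΦ2 y hy, hxy]

lemma tb_indep {K R ι : Type} [Field K] [IsAlgClosed K] [CommRing R] [IsDomain R]
    [Algebra K R] [Algebra.FiniteType K R] [Fintype ι]
    (hN : Algebra.trdeg K R = (Fintype.card ι : Cardinal)) (f : ι → R) (b : ι → K)
    (hfin : {φ : R →ₐ[K] K | ∀ i, φ (f i) = b i}.Finite)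
    (φ : R →ₐ[K] K) (hφ : ∀ i, φ (f i) = b i) : AlgebraicIndependent K f := by
  rw [algebraicIndependent_iff]
  intro p hp
  exact tb_I (J := Unit) hN f b hfin (fun _ => φ) (fun _ => hφ) (fun _ => 1) (by simp)
    (fun _ => p) (by simp [hp]) ()

lemma tb_Fa {K R ι : Type} [Field K] [IsAlgClosed K] [CharZero K] [CommRing R] [IsDomain R]
    [Algebra K R] [Algebra.FiniteType K R] [Fintype ι]
    (hN : Algebra.trdeg K R = (Fintype.card ι : Cardinal)) (f : ι → R) :
    ∃ D : ℕ, ∀ b : ι → K, {φ : R →ₐ[K] K | ∀ i, φ (f i) = b i}.Finite →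
        {φ : R →ₐ[K] K | ∀ i, φ (f i) = b i}.ncard ≤ D := by
  by_cases hf : AlgebraicIndependent K f
  · obtain ⟨D, -, h, -⟩ := tb_F hN f hf
    exact ⟨D, h⟩
  · refine ⟨0, fun b hb => ?_⟩
    rcases Set.eq_empty_or_nonempty {φ : R →ₐ[K] K | ∀ i, φ (f i) = b i} with h | ⟨φ, hφ⟩
    · rw [h]; simp
    · exact absurd (tb_indep hN f b hb φ hφ) hf


/-- every family of more than `k` polynomials is algebraically dependent on `Y` -/
def TBAD {K σ : Type} [Field K] (Y : Set (σ → K)) (k : ℕ) : Prop :=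
  ∀ (ι : Type) [Fintype ι], k < Fintype.card ι → ∀ F : ι → MvPolynomial σ K,
    ∃ P : MvPolynomial ι K, P ≠ 0 ∧ ∀ y ∈ Y, eval (fun i => eval y (F i)) P = 0

/-- cylinder over `X` -/
def TBcyl {K σ : Type} (X : Set (σ → K)) : Set (Option σ → K) := {w | (fun i => w (some i)) ∈ X}

lemma tb_ad1 {K σ S : Type} [Field K] [CommRing S] [Algebra K S] {k : ℕ}
    (ht : Algebra.trdeg K S ≤ (k : Cardinal)) (s : σ → S) (Y : Set (σ → K))
    (hY : ∀ y ∈ Y, ∃ φ : S →ₐ[K] K, ∀ i, φ (s i) = y i) : TBAD Y k := by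
  intro ι _ hk F
  obtain ⟨P, hP0, hP⟩ := tb_L1 ht (fun i => aeval s (F i)) hk
  refine ⟨P, hP0, fun y hy => ?_⟩
  obtain ⟨φ, hφ⟩ := hY y hy
  have h1 := congrArg φ hP
  rw [tb_ev, map_zero] at h1
  have h2 : (fun i => φ (s i)) = y := funext hφ
  simpa only [tb_ev, h2] using h1

lemma tb_ad2 {K σ S : Type} [Field K] [CommRing S] [IsDomain S] [Algebra K S] {k : ℕ}
    (ht : Algebra.trdeg K S ≤ ((k + 1 : ℕ) : Cardinal)) (h : S) (h0 : h ≠ 0) (s : σ → S)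
    (Y : Set (σ → K))
    (hY : ∀ y ∈ Y, ∃ φ : S →ₐ[K] K, φ h = 0 ∧ ∀ i, φ (s i) = y i) : TBAD Y k := by
  intro ι _ hk F
  obtain ⟨P, hP0, c, hc⟩ := tb_L1' (ht.trans (by exact_mod_cast hk)) h h0
    (fun i => aeval s (F i))
  refine ⟨P, hP0, fun y hy => ?_⟩
  obtain ⟨φ, hφ0, hφ⟩ := hY y hy
  have h1 := congrArg φ hc
  rw [tb_ev, map_mul, hφ0, zero_mul] at h1
  have h2 : (fun i => φ (s i)) = y := funext hφ
  simpa only [tb_ev, h2] using h1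

lemma tb_ad3 {K σ J : Type} [Field K] {k : ℕ} (t : Finset J) (Y : J → Set (σ → K))
    (hY : ∀ j ∈ t, TBAD (Y j) k) (Z : Set (σ → K)) (hZ : ∀ z ∈ Z, ∃ j ∈ t, z ∈ Y j) :
    TBAD Z k := by
  intro ι _ hk F
  have h := fun j (hj : j ∈ t) => hY j hj ι hk F
  choose! P hP0 hP using h
  refine ⟨∏ j ∈ t, P j, Finset.prod_ne_zero_iff.mpr hP0, fun z hz => ?_⟩
  obtain ⟨j, hj, hzj⟩ := hZ z hz
  rw [map_prod]
  exact Finset.prod_eq_zero hj (hP j hj z hzj)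

lemma tb_ad4 {K σ : Type} [Field K] [Infinite K] {k : ℕ} (X : Set (σ → K))
    (h : TBAD (TBcyl X) (k + 1)) : TBAD X k := by
  intro ι _ hk F
  obtain ⟨P, hP0, hP⟩ := h (Option ι) (by simpa using hk)
    (fun o => o.elim (MvPolynomial.X none) (fun i => rename some (F i)))
  obtain ⟨w, hw⟩ := tb_exists_eval P hP0
  have hval : ∀ v : ι → K, eval v (aeval (fun o : Option ι => o.elim (C (w none))
      MvPolynomial.X) P : MvPolynomial ι K) = eval (fun o : Option ι => o.elim (w none) v) P := by
    intro v
    have h1 := tb_ev (aeval v : MvPolynomial ι K →ₐ[K] K) (fun o : Option ι => o.elim (C (w none))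
      MvPolynomial.X) P
    rw [MvPolynomial.aeval_eq_eval] at h1
    refine h1.trans ?_
    congr 2
    funext o
    cases o <;> simp
  refine ⟨aeval (fun o : Option ι => o.elim (C (w none)) MvPolynomial.X) P, ?_, ?_⟩
  · intro h0
    apply hw
    have h1 := hval (fun i => w (some i))
    rw [h0, map_zero] at h1
    rw [h1]
    congr 2
    funext o
    cases o <;> rfl
  · intro x hx
    rw [hval]
    have h1 := hP (fun o => o.elim (w none) x) (by exact hx)
    rw [← h1]
    congr 2
    funext o
    cases o
    · simp
    · simp [eval_rename]
      rfl

lemma tb_opt_eval {K ι : Type} [Field K] (P : MvPolynomial (Option ι) K) (t : K) (w : ι → K) :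
    eval (fun o : Option ι => o.elim t w) P =
      ((optionEquivLeft K ι P).map (eval w)).eval t := by
  induction P using MvPolynomial.induction_on with
  | C a => simp [optionEquivLeft_C]
  | add p q hp hq => simp [hp, hq]
  | mul_X p i hp =>
    rw [map_mul, map_mul, hp, Polynomial.map_mul, Polynomial.eval_mul]
    cases i <;> simp [optionEquivLeft_X_none, optionEquivLeft_X_some]

lemma tb_G {K σ ι : Type} [Field K] [Finite σ] [Fintype ι] {k : ℕ} (Y : Set (σ → K))
    (hY : TBAD Y k) (F : ι → MvPolynomial σ K) (hk : k ≤ Fintype.card ι) :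
    ∃ g : MvPolynomial ι K, g ≠ 0 ∧ ∀ w, eval w g ≠ 0 →
      {y ∈ Y | ∀ i, eval y (F i) = w i}.Finite := by
  classical
  have := Fintype.ofFinite σ
  have h1 : ∀ j : σ, ∃ P : MvPolynomial (Option ι) K, P ≠ 0 ∧ ∀ y ∈ Y,
      eval (fun o => eval y (o.elim (X j) F)) P = 0 := fun j =>
    hY (Option ι) (by simp; omega) _
  choose P hP0 hP using h1
  refine ⟨∏ j, (optionEquivLeft K ι (P j)).leadingCoeff, ?_, ?_⟩
  · rw [Finset.prod_ne_zero_iff]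
    intro j _
    rw [Polynomial.leadingCoeff_ne_zero]
    simpa using hP0 j
  intro w hw
  rw [map_prod, Finset.prod_ne_zero_iff] at hw
  have hq : ∀ j, (optionEquivLeft K ι (P j)).map (eval w) ≠ 0 := by
    intro j h
    have h2 := congrArg (fun q => Polynomial.coeff q (optionEquivLeft K ι (P j)).natDegree) h
    simp only [Polynomial.coeff_map, Polynomial.coeff_zero] at h2
    exact hw j (Finset.mem_univ j) h2
  have hpi : (Set.pi Set.univ (fun j => {t | t ∈ ((optionEquivLeft K ι (P j)).map
      (eval w)).roots.toFinset})).Finite := Set.Finite.pi' (fun j => Finset.finite_toSet _) |>.subset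
        (fun x hx i => hx i (Set.mem_univ i))
  refine hpi.subset ?_
  rintro y ⟨hy, hyw⟩ j -
  simp only [Set.mem_ofPred_eq, Multiset.mem_toFinset]
  rw [Polynomial.mem_roots (hq j), Polynomial.IsRoot, ← tb_opt_eval, ← hP j y hy]
  congr 2
  funext o
  cases o <;> simp [hyw]

lemma tb_P {K σ ι : Type} [Field K] [Finite σ] [Fintype ι] {k : ℕ} (X : Set (σ → K))
    (hX : TBAD (TBcyl X) k) (F : ι → MvPolynomial σ K) (hk : k ≤ Fintype.card ι) :
    ∃ g : MvPolynomial ι K, g ≠ 0 ∧ ∀ w, eval w g ≠ 0 →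
      {x ∈ X | ∃ t, ∀ i, t * eval x (F i) = w i}.Finite := by
  obtain ⟨g, hg0, hg⟩ := tb_G _ hX (fun i => MvPolynomial.X none * rename some (F i)) hk
  refine ⟨g, hg0, fun w hw => ?_⟩
  refine ((hg w hw).image (fun (y : Option σ → K) i => y (some i))).subset ?_
  rintro x ⟨hx, t, ht⟩
  refine ⟨fun o => o.elim t x, ⟨hx, fun i => ?_⟩, rfl⟩
  rw [← ht i]
  simp [eval_rename]
  left
  rfl

lemma tb_surj {K M : Type} [Field K] [AddCommGroup M] [Module K M] [FiniteDimensional K M]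
    (W : Submodule K M) (m : ℕ) (hm : Module.finrank K W + m ≤ Module.finrank K M) :
    ∃ l : M →ₗ[K] (Fin m → K), Function.Surjective l ∧ ∀ x ∈ W, l x = 0 := by
  have h1 := W.finrank_quotient_add_finrank
  let B := Module.finBasis K (M ⧸ W)
  have hm' : m ≤ Module.finrank K (M ⧸ W) := by omega
  refine ⟨(LinearMap.funLeft K K (Fin.castLE hm')).comp
    (B.equivFun.toLinearMap.comp W.mkQ), ?_, ?_⟩
  · intro w
    obtain ⟨v, hv⟩ : ∃ v : Fin (Module.finrank K (M ⧸ W)) → K,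
        LinearMap.funLeft K K (Fin.castLE hm') v = w :=
      LinearMap.funLeft_surjective_of_injective K K _ (Fin.castLE_injective hm') w
    obtain ⟨x, hx⟩ := W.mkQ_surjective (B.equivFun.symm v)
    refine ⟨x, ?_⟩
    rw [LinearMap.comp_apply, LinearMap.comp_apply, hx, LinearEquiv.coe_coe,
      LinearEquiv.apply_symm_apply]
    exact hv
  · intro x hx
    have : W.mkQ x = 0 := by simpa using hx
    rw [LinearMap.comp_apply, LinearMap.comp_apply, this]
    simp

lemma tb_H {K σ ι : Type} [Field K] [Infinite K] [Finite σ] [Fintype ι] {k : ℕ} (X : Set (σ → K))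
    (hX : TBAD (TBcyl X) (k + 1)) (f : ι → MvPolynomial σ K) :
    ∀ (m : ℕ) (W : Submodule K (ι → K)), {x ∈ X | (fun i => eval x (f i)) ∈ W}.Finite →
      Module.finrank K W + m = Fintype.card ι - k →
    ∃ W' : Submodule K (ι → K), W ≤ W' ∧ Module.finrank K W' = Fintype.card ι - k ∧
      {x ∈ X | (fun i => eval x (f i)) ∈ W'}.Finite := by
  classical
  intro m
  induction m with
  | zero => intro W hW hm; exact ⟨W, le_rfl, hm, hW⟩
  | succ m ih =>
    intro W hW hm
    obtain ⟨l, hl, hlW⟩ := tb_surj W (k + 1) (by simp; omega)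
    have hlin : ∀ x i, l (fun j => eval x (f j)) i =
        eval x (∑ j, C (l (Pi.single j 1) i) * f j) := by
      intro x i
      conv_lhs => rw [LinearMap.pi_apply_eq_sum_univ l]
      simp [Finset.sum_apply, mul_comm]
      refine Finset.sum_congr rfl fun j _ => ?_
      have h : (fun t => if j = t then (1 : K) else 0) = Pi.single j 1 := by
        funext t
        simp [Pi.single_apply, eq_comm]
      rw [h]
    obtain ⟨g, hg0, hg⟩ := tb_P X hX (fun i : Fin (k + 1) => ∑ j, C (l (Pi.single j 1) i) * f j)
      (by simp)
    obtain ⟨w, hw⟩ := tb_exists_eval (g * MvPolynomial.X 0) (mul_ne_zero hg0 (X_ne_zero 0))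
    rw [map_mul, eval_X] at hw
    obtain ⟨e, he⟩ := hl w
    have heW : e ∉ W := by
      intro h
      have h1 := hlW e h
      rw [he] at h1
      rw [h1] at hw
      simp at hw
    obtain ⟨W', hle, hW', hfin⟩ := ih (W ⊔ K ∙ e) (by
      refine (hW.union (hg w (left_ne_zero_of_mul hw))).subset ?_
      rintro x ⟨hx, hxW⟩
      obtain ⟨w', hw', y, hy, hsum⟩ := Submodule.mem_sup.mp hxW
      obtain ⟨c, rfl⟩ := Submodule.mem_span_singleton.mp hy
      by_cases hc : c = 0
      · left
        refine ⟨hx, ?_⟩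
        rw [← hsum, hc]; simpa using hw'
      · right
        refine ⟨hx, c⁻¹, fun i => ?_⟩
        rw [← hlin, ← hsum, map_add, map_smul, hlW w' hw', he]
        simp [hc]) (by
      have h1 := Submodule.finrank_sup_add_finrank_inf_eq W (K ∙ e)
      have h2 : W ⊓ (K ∙ e) = ⊥ := by
        rw [eq_bot_iff]
        rintro y ⟨hy1, hy2⟩
        obtain ⟨c, rfl⟩ := Submodule.mem_span_singleton.mp hy2
        by_cases hc : c = 0
        · simp [hc]
        · exfalso
          apply heW
          have := W.smul_mem c⁻¹ hy1
          rwa [smul_smul, inv_mul_cancel₀ hc, one_smul] at this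
      have he0 : e ≠ 0 := fun h => heW (by rw [h]; exact W.zero_mem)
      rw [h2, finrank_bot, finrank_span_singleton he0] at h1
      omega)
    exact ⟨W', le_sup_left.trans hle, hW', hfin⟩


lemma tb_mem_van {K : Type} [Field K] {n : ℕ} {V : Set (Fin n → K)}
    {p : MvPolynomial (Fin n) K} :
    p ∈ vanishingIdeal K V ↔ ∀ x ∈ V, eval x p = 0 := by
  rw [mem_vanishingIdeal_iff]
  simp only [MvPolynomial.aeval_eq_eval]

lemma tb_alg_mem {K : Type} [Field K] {n : ℕ} {V : Set (Fin n → K)} (hV : IsAlgebraicSet V)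
    (x : Fin n → K) (hx : ∀ p ∈ vanishingIdeal K V, eval x p = 0) : x ∈ V := by
  obtain ⟨I, hI⟩ := hV
  rw [hI, mem_zeroLocus_iff]
  intro p hp
  rw [MvPolynomial.aeval_eq_eval]
  apply hx
  rw [tb_mem_van]
  intro y hy
  rw [hI, mem_zeroLocus_iff] at hy
  have := hy p hp
  rwa [MvPolynomial.aeval_eq_eval] at this

/-- coordinate ring -/
abbrev TBR {K : Type} [Field K] {n : ℕ} (V : Set (Fin n → K)) : Type :=
  MvPolynomial (Fin n) K ⧸ vanishingIdeal K V

lemma tb_pt_of_mem {K : Type} [Field K] {n : ℕ} {V : Set (Fin n → K)} (x : Fin n → K)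
    (hx : x ∈ V) : ∃ φ : TBR V →ₐ[K] K, ∀ p, φ (Ideal.Quotient.mk _ p) = eval x p := by
  refine ⟨Ideal.Quotient.liftₐ _ (aeval x) (fun p hp => ?_), fun p => ?_⟩
  · rw [MvPolynomial.aeval_eq_eval]; exact tb_mem_van.mp hp x hx
  · rw [← Ideal.Quotient.mkₐ_eq_mk K, Ideal.Quotient.liftₐ_apply]
    simp [MvPolynomial.aeval_eq_eval]

lemma tb_pt_eval {K : Type} [Field K] {n : ℕ} {V : Set (Fin n → K)} (φ : TBR V →ₐ[K] K)
    (p : MvPolynomial (Fin n) K) : φ (Ideal.Quotient.mk _ p) =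
      eval (fun i => φ (Ideal.Quotient.mk _ (X i))) p := by
  have h := tb_ev φ (fun i => (Ideal.Quotient.mk (vanishingIdeal K V) (X i))) p
  rw [← h]
  congr 1
  have h2 : (Ideal.Quotient.mkₐ K (vanishingIdeal K V)) =
      aeval (fun i => (Ideal.Quotient.mk (vanishingIdeal K V) (X i))) := by
    ext i; simp
  exact congrArg (fun f : MvPolynomial (Fin n) K →ₐ[K] TBR V => f p) h2

lemma tb_pt_mem {K : Type} [Field K] {n : ℕ} {V : Set (Fin n → K)} (hV : IsAlgebraicSet V)
    (φ : TBR V →ₐ[K] K) : (fun i => φ (Ideal.Quotient.mk _ (X i))) ∈ V := by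
  apply tb_alg_mem hV
  intro p hp
  rw [← tb_pt_eval, Ideal.Quotient.eq_zero_iff_mem.mpr hp, map_zero]

lemma tb_trdeg {K : Type} [Field K] {n : ℕ} {V : Set (Fin n → K)} (hV : IsIrreducibleVariety V) :
    Algebra.trdeg K (TBR V) = (varDim V : Cardinal) := by
  have := hV.2
  have : IsDomain (TBR V) := Ideal.Quotient.isDomain _
  obtain ⟨N, h1, h2, -⟩ := tb_L2 K (TBR V)
  rw [h1, varDim, h2]
  rfl

lemma tb_trdeg_mv {K R τ : Type} [Field K] [CommRing R] [IsDomain R] [Algebra K R] [Fintype τ]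
    {k : ℕ} (hk : Algebra.trdeg K R = (k : Cardinal)) :
    Algebra.trdeg K (MvPolynomial τ R) = ((k + Fintype.card τ : ℕ) : Cardinal) := by
  have h1 := trdeg_add_eq K R (A := MvPolynomial τ R)
  rw [← h1, hk, MvPolynomial.trdeg_of_isDomain]
  simp

lemma tb_ext_mv {K R τ : Type} [Field K] [CommRing R] [Algebra K R] (φ : R →ₐ[K] K) (w : τ → K) :
    ∃ ψ : MvPolynomial τ R →ₐ[K] K, (∀ r, ψ (C r) = φ r) ∧ ∀ j, ψ (X j) = w j :=
  ⟨{ eval₂Hom (φ : R →+* K) w with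
      commutes' := fun c => by
        rw [MvPolynomial.algebraMap_apply]
        simp }, fun r => by simp, fun j => by simp⟩

lemma tb_ad1c {K σ S : Type} [Field K] [CommRing S] [IsDomain S] [Algebra K S] {k : ℕ}
    (ht : Algebra.trdeg K S = (k : Cardinal)) (s : σ → S) (Y : Set (σ → K))
    (hY : ∀ y ∈ Y, ∃ φ : S →ₐ[K] K, ∀ i, φ (s i) = y i) : TBAD (TBcyl Y) (k + 1) := by
  have h1 := tb_trdeg_mv (τ := Unit) ht
  refine tb_ad1 (S := MvPolynomial Unit S) (by rw [h1]; simp)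
    (fun o => o.elim (X ()) (fun i => C (s i))) _ ?_
  intro w hw
  obtain ⟨φ, hφ⟩ := hY _ hw
  obtain ⟨ψ, h2, h3⟩ := tb_ext_mv φ (fun _ : Unit => w none)
  refine ⟨ψ, fun o => ?_⟩
  cases o with
  | none => exact h3 ()
  | some i => exact (h2 (s i)).trans (hφ i)

lemma tb_ad2c {K σ S : Type} [Field K] [CommRing S] [IsDomain S] [Algebra K S] {k : ℕ}
    (ht : Algebra.trdeg K S = (k : Cardinal)) (h : S) (h0 : h ≠ 0) (s : σ → S) (Y : Set (σ → K))
    (hY : ∀ y ∈ Y, ∃ φ : S →ₐ[K] K, φ h = 0 ∧ ∀ i, φ (s i) = y i) : TBAD (TBcyl Y) k := by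
  have h1 := tb_trdeg_mv (τ := Unit) ht
  refine tb_ad2 (S := MvPolynomial Unit S) (by rw [h1]; simp) (C h)
    (by rwa [Ne, C_eq_zero]) (fun o => o.elim (X ()) (fun i => C (s i))) _ ?_
  intro w hw
  obtain ⟨φ, hφ0, hφ⟩ := hY _ hw
  obtain ⟨ψ, h2, h3⟩ := tb_ext_mv φ (fun _ : Unit => w none)
  refine ⟨ψ, by rw [h2, hφ0], fun o => ?_⟩
  cases o with
  | none => exact h3 ()
  | some i => exact (h2 (s i)).trans (hφ i)

lemma tb_adV {K : Type} [Field K] {n : ℕ} {V : Set (Fin n → K)} (hV : IsIrreducibleVariety V) :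
    TBAD (TBcyl V) (varDim V + 1) := by
  have := hV.2
  have : IsDomain (TBR V) := Ideal.Quotient.isDomain _
  refine tb_ad1c (tb_trdeg hV) (fun i => Ideal.Quotient.mk _ (X i)) _ ?_
  intro y hy
  obtain ⟨φ, hφ⟩ := tb_pt_of_mem y hy
  exact ⟨φ, fun i => by simp [hφ]⟩

lemma tb_adV0 {K : Type} [Field K] {n : ℕ} {V : Set (Fin n → K)} (hV : IsIrreducibleVariety V)
    (h : MvPolynomial (Fin n) K) (hh : ∃ x ∈ V, eval x h ≠ 0) :
    TBAD (TBcyl {x ∈ V | eval x h = 0}) (varDim V) := by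
  have := hV.2
  have : IsDomain (TBR V) := Ideal.Quotient.isDomain _
  refine tb_ad2c (tb_trdeg hV) (Ideal.Quotient.mk _ h) ?_ (fun i => Ideal.Quotient.mk _ (X i)) _ ?_
  · rw [Ne, Ideal.Quotient.eq_zero_iff_mem, tb_mem_van]
    push Not
    exact hh
  · rintro y ⟨hy, hy0⟩
    obtain ⟨φ, hφ⟩ := tb_pt_of_mem y hy
    exact ⟨φ, by rw [hφ, hy0], fun i => by simp [hφ]⟩

/-- tangent space as a submodule -/
def TBT {K : Type} [Field K] {n : ℕ} (V : Set (Fin n → K)) (p : Fin n → K) :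
    Submodule K (Fin n → K) where
  carrier := tangentSpaceAt V p
  zero_mem' := by intro f _; simp
  add_mem' := by
    intro a b ha hb f hf
    have h1 := ha f hf
    have h2 := hb f hf
    simp only [Pi.add_apply, mul_add, Finset.sum_add_distrib, h1, h2, add_zero]
  smul_mem' := by
    intro c a ha f hf
    have h1 := ha f hf
    have h2 : ∑ i, eval p (pderiv i f) * (c • a) i = c * ∑ i, eval p (pderiv i f) * a i := by
      rw [Finset.mul_sum]
      exact Finset.sum_congr rfl fun i _ => by simp; ring
    rw [h2, h1, mul_zero]

lemma tb_memT {K : Type} [Field K] {n : ℕ} {V : Set (Fin n → K)} {p y : Fin n → K} :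
    y ∈ TBT V p ↔ ∀ f ∈ vanishingIdeal K V, ∑ i, eval p (pderiv i f) * y i = 0 := Iff.rfl

lemma tb_finrankT {K : Type} [Field K] {n : ℕ} {V : Set (Fin n → K)} (h : IsSmoothVariety V)
    (p : Fin n → K) (hp : p ∈ V) : Module.finrank K (TBT V p) = varDim V := by
  have h1 := h p hp
  rw [IsSmoothAt, tangentDimAt] at h1
  have : Submodule.span K (tangentSpaceAt V p) = TBT V p := Submodule.span_eq (TBT V p)
  rw [← h1, this]


lemma tb_dot {K : Type} [Field K] {n : ℕ} (l : (Fin n → K) →ₗ[K] K) (y : Fin n → K) :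
    l y = ∑ i, l (Pi.single i 1) * y i := by
  conv_lhs => rw [← Finset.univ_sum_single y]
  rw [map_sum]
  refine Finset.sum_congr rfl fun i _ => ?_
  have : (Pi.single i (y i) : Fin n → K) = y i • Pi.single i 1 := by
    rw [← Pi.single_smul]; simp
  rw [this, map_smul, smul_eq_mul, mul_comm]

/-- extension to a basis by elements of a spanning set -/
lemma tb_basis_ext {K : Type} [Field K] {n : ℕ} (s t : Set (Fin n → K)) (hst : s ⊆ t)
    (hs : LinearIndepOn K id s) (ht : ∀ y : Fin n → K, (∀ u ∈ t, ∑ i, u i * y i = 0) → y = 0) :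
    ∃ e : Fin n → (Fin n → K), LinearIndependent K e ∧ (∀ k, e k ∈ t) ∧ s ⊆ Set.range e := by
  obtain ⟨b, hbt, hsb, htb, hb⟩ := exists_linearIndepOn_extension hs hst
  rw [Set.image_id, Set.image_id] at htb
  have htop : Submodule.span K b = ⊤ := by
    by_contra hne
    obtain ⟨f, hf0, hf⟩ := Submodule.exists_le_ker_of_lt_top _ (lt_top_iff_ne_top.mpr hne)
    apply hf0
    have h0 : (fun i => f (Pi.single i 1)) = 0 := by
      apply ht
      intro u hu
      have h1 : f u = 0 := hf (htb hu)
      rw [tb_dot] at h1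
      rw [← h1]
      exact Finset.sum_congr rfl fun i _ => mul_comm _ _
    ext i
    simpa using congrFun h0 i
  have hb' : LinearIndependent K ((↑) : b → (Fin n → K)) := hb
  let B := Module.Basis.mk hb' (by simp [htop])
  let e := (Pi.basisFun K (Fin n)).indexEquiv B
  refine ⟨fun k => (e k : Fin n → K), hb'.comp e e.injective, fun k => hbt (e k).2, ?_⟩
  intro u hu
  exact ⟨e.symm ⟨u, hsb hu⟩, by simp⟩

lemma tb_frame0 {K : Type} [Field K] {n : ℕ} (T : Submodule K (Fin n → K)) :
    ∃ E : Fin (Module.finrank K T) → (Fin n → K), LinearIndependent K E ∧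
      ∀ y ∈ T, (∀ j, ∑ i, E j i * y i = 0) → y = 0 := by
  obtain ⟨g, hg⟩ := LinearMap.exists_leftInverse_of_injective T.subtype (by simp)
  let b0 := Module.finBasis K T
  let l : Fin (Module.finrank K T) → ((Fin n → K) →ₗ[K] K) := fun j => (b0.coord j).comp g
  have hgl : ∀ y (hy : y ∈ T), g y = ⟨y, hy⟩ := fun y hy =>
    congrArg (fun f : T →ₗ[K] T => f ⟨y, hy⟩) hg
  refine ⟨fun j i => l j (Pi.single i 1), ?_, ?_⟩
  · rw [Fintype.linearIndependent_iff]
    intro c hc k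
    have h1 : ∑ j, c j * l j (b0 k) = 0 := by
      have h2 : ∀ j, l j (b0 k) = ∑ i, l j (Pi.single i 1) * (b0 k : Fin n → K) i :=
        fun j => tb_dot _ _
      simp only [h2, Finset.mul_sum]
      rw [Finset.sum_comm]
      refine Finset.sum_eq_zero fun i _ => ?_
      have h3 := congrFun hc i
      simp only [Finset.sum_apply, Pi.smul_apply, smul_eq_mul, Pi.zero_apply] at h3
      rw [← zero_mul ((b0 k : Fin n → K) i), ← h3, Finset.sum_mul]
      exact Finset.sum_congr rfl fun j _ => by ring
    rw [Finset.sum_eq_single k] at h1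
    · simpa [l, hgl _ (b0 k).2] using h1
    · intro j _ hj
      simp [l, hgl _ (b0 k).2, Finsupp.single_eq_of_ne hj]
    · simp
  · intro y hy h
    have h1 : (⟨y, hy⟩ : T) = 0 := by
      apply b0.repr.injective
      ext j
      have := h j
      rw [← tb_dot] at this
      simpa [l, hgl y hy] using this
    exact congrArg Subtype.val h1

lemma tb_frame {K : Type} [Field K] {n : ℕ} {V : Set (Fin n → K)} (hs : IsSmoothVariety V)
    (p : Fin n → K) (hp : p ∈ V) :
    ∃ (h : MvPolynomial (Fin n) K) (E : Fin (varDim V) → (Fin n → K))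
      (B : Fin n → Fin (varDim V) → MvPolynomial (Fin n) K), eval p h ≠ 0 ∧
      ∀ x ∈ V, eval x h ≠ 0 →
        (∀ y ∈ TBT V x, ∀ i, eval x h * y i = ∑ j, eval x (B i j) * ∑ k, E j k * y k) ∧
        ∀ t : Fin (varDim V) → K, (fun i => ∑ j, eval x (B i j) * t j) ∈ TBT V x ∧
          ∀ j, ∑ k, E j k * (∑ j', eval x (B k j') * t j') = eval x h * t j := by
  classical
  have hd := tb_finrankT hs p hp
  have h00 := tb_frame0 (TBT V p)
  rw [hd] at h00
  obtain ⟨E, hE1, hE2⟩ := h00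
  let G : Set (Fin n → K) := {u | ∃ φ ∈ vanishingIdeal K V, ∀ i, u i = eval p (pderiv i φ)}
  obtain ⟨e, he1, he2, he3⟩ := tb_basis_ext (Set.range E) (G ∪ Set.range E)
    Set.subset_union_right hE1.linearIndepOn_id (by
      intro y hy
      apply hE2 y
      · intro φ hφ
        exact hy _ (Or.inl ⟨φ, hφ, fun i => rfl⟩)
      · intro j
        exact hy _ (Or.inr ⟨j, rfl⟩))
  have hm : ∀ j, ∃ k, e k = E j := fun j => he3 ⟨j, rfl⟩
  choose m hm using hm
  have hminj : Function.Injective m := by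
    intro a b hab
    apply hE1.injective
    rw [← hm, ← hm, hab]
  have hφ : ∀ k, ∃ φ : MvPolynomial (Fin n) K, k ∉ Set.range m →
      φ ∈ vanishingIdeal K V ∧ ∀ i, e k i = eval p (pderiv i φ) := by
    intro k
    by_cases hk : k ∈ Set.range m
    · exact ⟨0, fun h => absurd hk h⟩
    · rcases he2 k with ⟨φ, h1, h2⟩ | ⟨j, hj⟩
      · exact ⟨φ, fun _ => ⟨h1, h2⟩⟩
      · exact absurd ⟨j, he1.injective ((hm j).trans hj)⟩ hk
  choose φ hφ using hφ
  let Mat : Matrix (Fin n) (Fin n) (MvPolynomial (Fin n) K) :=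
    Matrix.of fun k i => if k ∈ Set.range m then C (e k i) else pderiv i (φ k)
  have hMatm : ∀ x j i, eval x (Mat (m j) i) = E j i := by
    intro x j i
    simp [Mat, hm]
  have hMatn : ∀ k, k ∉ Set.range m → ∀ i, Mat k i = pderiv i (φ k) := by
    intro k hk i
    simp only [Mat, Matrix.of_apply, if_neg hk]
  have hMatp : Mat.map (eval p) = Matrix.of e := by
    ext k i
    by_cases hk : k ∈ Set.range m
    · simp only [Mat, Matrix.map_apply, Matrix.of_apply, if_pos hk, eval_C]
    · rw [Matrix.map_apply, hMatn k hk, Matrix.of_apply, (hφ k hk).2]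
  have key1 : ∀ x i k, ∑ l, eval x (Mat.adjugate i l) * eval x (Mat l k) =
      if i = k then eval x Mat.det else 0 := by
    intro x i k
    have h1 := congrArg (fun A : Matrix (Fin n) (Fin n) _ => eval x (A i k)) (Matrix.adjugate_mul Mat)
    simp only [Matrix.mul_apply, map_sum, map_mul, Matrix.smul_apply, Matrix.one_apply,
      smul_eq_mul] at h1
    rw [h1]
    split_ifs <;> simp
  have key2 : ∀ x i k, ∑ l, eval x (Mat i l) * eval x (Mat.adjugate l k) =
      if i = k then eval x Mat.det else 0 := by
    intro x i k
    have h1 := congrArg (fun A : Matrix (Fin n) (Fin n) _ => eval x (A i k)) (Matrix.mul_adjugate Mat)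
    simp only [Matrix.mul_apply, map_sum, map_mul, Matrix.smul_apply, Matrix.one_apply,
      smul_eq_mul] at h1
    rw [h1]
    split_ifs <;> simp
  refine ⟨Mat.det, E, fun i j => Mat.adjugate i (m j), ?_, ?_⟩
  · have h1 : eval p Mat.det = (Mat.map (eval p)).det := RingHom.map_det (eval p) Mat
    rw [h1, hMatp]
    have h2 : IsUnit (Matrix.of e) := by
      rw [← Matrix.linearIndependent_rows_iff_isUnit]
      exact he1
    rw [Matrix.isUnit_iff_isUnit_det] at h2
    exact h2.ne_zero
  · intro x hx hx0
    have hA : ∀ y ∈ TBT V x, ∀ i, eval x Mat.det * y i =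
        ∑ j, eval x (Mat.adjugate i (m j)) * ∑ k, E j k * y k := by
      intro y hy i
      have h1 : ∑ l, eval x (Mat.adjugate i l) * ∑ k, eval x (Mat l k) * y k =
          eval x Mat.det * y i := by
        simp only [Finset.mul_sum]
        rw [Finset.sum_comm]
        simp only [← mul_assoc, ← Finset.sum_mul, key1]
        simp
      rw [← h1]
      symm
      apply Fintype.sum_of_injective m hminj
      · intro k hk
        simp only [hMatn k hk]
        rw [tb_memT.mp hy _ (hφ k hk).1, mul_zero]
      · intro j
        simp only [hMatm]
    have hB : ∀ (t : Fin (varDim V) → K) j, ∑ k, E j k * (∑ j', eval x (Mat.adjugate k (m j')) * t j')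
        = eval x Mat.det * t j := by
      intro t j
      simp only [Finset.mul_sum]
      rw [Finset.sum_comm]
      simp only [← mul_assoc, ← Finset.sum_mul, ← hMatm x, key2, hminj.eq_iff]
      simp
    refine ⟨hA, fun t => ⟨?_, hB t⟩⟩
    let l : TBT V x →ₗ[K] (Fin (varDim V) → K) :=
      { toFun := fun y j => ∑ k, E j k * (y : Fin n → K) k
        map_add' := fun a b => by
          ext j; simp [mul_add, Finset.sum_add_distrib]
        map_smul' := fun c a => by
          ext j
          simp only [Submodule.coe_smul, Pi.smul_apply, smul_eq_mul, RingHom.id_apply,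
            Finset.mul_sum]
          exact Finset.sum_congr rfl fun k _ => by ring }
    have hl : ∀ y j, l y j = ∑ k, E j k * (y : Fin n → K) k := fun _ _ => rfl
    have hinj : Function.Injective l := by
      rw [← LinearMap.ker_eq_bot, LinearMap.ker_eq_bot']
      intro y hy
      ext i
      have h1 := hA y y.2 i
      simp only [← hl, hy] at h1
      simpa [hx0] using h1
    have hsurj : Function.Surjective l :=
      (LinearMap.injective_iff_surjective_of_finrank_eq_finrank (by
        rw [tb_finrankT hs x hx]; simp)).mp hinj
    obtain ⟨y, hy⟩ := hsurj t
    have h2 : (fun i => ∑ j, eval x (Mat.adjugate i (m j)) * t j) =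
        eval x Mat.det • (y : Fin n → K) := by
      ext i
      rw [Pi.smul_apply, smul_eq_mul, hA y y.2 i]
      simp only [← hl, hy]
    rw [h2]
    exact Submodule.smul_mem _ _ y.2


lemma tb_restr {K : Type} [Field K] {n : ℕ} {τ : Type} {V : Set (Fin n → K)}
    (hV : IsAlgebraicSet V) (φ : MvPolynomial τ (TBR V) →ₐ[K] K) :
    ∃ x ∈ V, ∀ p : MvPolynomial (Fin n) K, φ (C (Ideal.Quotient.mk _ p)) = eval x p := by
  let ψ : TBR V →ₐ[K] K := φ.comp (IsScalarTower.toAlgHom K (TBR V) (MvPolynomial τ (TBR V)))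
  exact ⟨_, tb_pt_mem hV ψ, fun p => tb_pt_eval ψ p⟩

lemma tb_irr {K : Type} [Field K] {n : ℕ} {V : Set (Fin n → K)}
    (hV : IsIrreducibleVariety V) {h : MvPolynomial (Fin n) K} (hh : ∃ x ∈ V, eval x h ≠ 0)
    (q : MvPolynomial (Fin n) K) (hq : ∀ x ∈ V, eval x h ≠ 0 → eval x q = 0) :
    ∀ x ∈ V, eval x q = 0 := by
  have h1 : q * h ∈ vanishingIdeal K V := by
    rw [tb_mem_van]
    intro x hx
    rw [map_mul]
    by_cases h0 : eval x h = 0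
    · rw [h0, mul_zero]
    · rw [hq x hx h0, zero_mul]
  rcases hV.2.mem_or_mem h1 with h2 | h2
  · exact tb_mem_van.mp h2
  · obtain ⟨x, hx, h3⟩ := hh
    exact absurd (tb_mem_van.mp h2 x hx) h3

lemma tb_chart {K : Type} [Field K] [IsAlgClosed K] {n : ℕ} {V : Set (Fin n → K)}
    (hV : IsIrreducibleVariety V) (hs : IsSmoothVariety V) (p : Fin n → K) (hp : p ∈ V) :
    ∃ (h : MvPolynomial (Fin n) K) (z : Fin (n + n) → MvPolynomial (Fin (varDim V)) (TBR V)),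
      eval p h ≠ 0 ∧
      (∀ w ∈ tangentBundle V, eval (fstProj w) h ≠ 0 →
        ∃ φ : MvPolynomial (Fin (varDim V)) (TBR V) →ₐ[K] K, ∀ i, φ (z i) = w i) ∧
      (∀ φ : MvPolynomial (Fin (varDim V)) (TBR V) →ₐ[K] K, (fun i => φ (z i)) ∈ tangentBundle V) ∧
      ∃ θ : MvPolynomial (Fin (varDim V)) (TBR V) →ₐ[K] MvPolynomial (Fin (varDim V)) (TBR V),
        Function.Injective θ ∧ ∀ s, θ s ∈ (aeval (R := K) z).range := by
  have := hV.2
  have : IsDomain (TBR V) := Ideal.Quotient.isDomain _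
  obtain ⟨h, E, B, hhp, hfr⟩ := tb_frame hs p hp
  let z : Fin (n + n) → (MvPolynomial (Fin (varDim V)) (TBR V)) := Fin.append (fun i => C (Ideal.Quotient.mk _ (X i)))
    (fun i => ∑ j, C (Ideal.Quotient.mk _ (B i j)) * X j)
  have hz1 : ∀ i, z (Fin.castAdd n i) = C (Ideal.Quotient.mk _ (X i)) := by simp [z]
  have hz2 : ∀ i, z (Fin.natAdd n i) = ∑ j, C (Ideal.Quotient.mk _ (B i j)) * X j := fun i => by
    simp only [z, Fin.append_right]
  refine ⟨h, z, hhp, ?_, ?_, ?_⟩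
  · rintro w ⟨hw1, hw2⟩ hw0
    obtain ⟨φ, hφ⟩ := tb_pt_of_mem _ hw1
    obtain ⟨ψ, h1, h2⟩ := tb_ext_mv φ
      (fun j => (∑ k, E j k * sndProj w k) / eval (fstProj w) h)
    refine ⟨ψ, fun i => ?_⟩
    refine Fin.addCases (fun i => ?_) (fun i => ?_) i
    · rw [hz1, h1, hφ, eval_X]; rfl
    · have h3 := (hfr _ hw1 hw0).1 _ hw2 i
      rw [hz2, map_sum]
      simp only [map_mul, h1, h2, hφ]
      have : w (Fin.natAdd n i) = sndProj w i := rfl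
      rw [this]
      apply mul_left_cancel₀ hw0
      rw [h3, Finset.mul_sum]
      refine Finset.sum_congr rfl fun j _ => ?_
      field_simp
  · intro φ
    obtain ⟨x, hx, hφ⟩ := tb_restr hV.1 φ
    have hf : fstProj (fun i => φ (z i)) = x := by
      ext i
      simp only [fstProj, hz1, hφ, eval_X]
    have hsn : sndProj (fun i => φ (z i)) = fun i => ∑ j, eval x (B i j) * φ (X j) := by
      ext i
      simp only [sndProj, hz2, map_sum, map_mul, hφ]
    refine ⟨by rw [hf]; exact hx, ?_⟩
    rw [hf, hsn]
    intro f hfI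
    have h1 := tb_irr hV ⟨p, hp, hhp⟩
      (∑ i, pderiv i f * ∑ j, B i j * C (φ (X j))) (fun y hy hy0 => by
        have h2 := ((hfr y hy hy0).2 (fun j => φ (X j))).1 f hfI
        simpa using h2) x hx
    simpa using h1
  · obtain ⟨θ, hθ1, hθ2⟩ : ∃ θ : (MvPolynomial (Fin (varDim V)) (TBR V)) →ₐ[K] (MvPolynomial (Fin (varDim V)) (TBR V)), (∀ r, θ (C r) = C r) ∧
        ∀ j, θ (X j) = C (Ideal.Quotient.mk _ h) * X j :=
      ⟨(aeval (R := TBR V) (fun j => (C (Ideal.Quotient.mk _ h) * X j : (MvPolynomial (Fin (varDim V)) (TBR V))))).restrictScalars K,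
        fun r => by simp, fun j => by simp⟩
    have hXr : ∀ r : TBR V, (C r : (MvPolynomial (Fin (varDim V)) (TBR V))) ∈ (aeval (R := K) z).range := by
      intro r
      obtain ⟨q, rfl⟩ := Ideal.Quotient.mk_surjective r
      refine ⟨rename (Fin.castAdd n) q, ?_⟩
      change aeval z (rename (Fin.castAdd n) q) = _
      rw [aeval_rename]
      let C' : MvPolynomial (Fin n) K →ₐ[K] (MvPolynomial (Fin (varDim V)) (TBR V)) :=
        (IsScalarTower.toAlgHom K (TBR V) (MvPolynomial (Fin (varDim V)) (TBR V))).comp (Ideal.Quotient.mkₐ K (vanishingIdeal K V))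
      have h1 : aeval (z ∘ Fin.castAdd n) = C' := by
        ext i : 1
        simp only [aeval_X, Function.comp_apply, hz1]
        rfl
      rw [h1]
      rfl
    refine ⟨θ, ?_, ?_⟩
    · rw [injective_iff_map_eq_zero]
      intro P hP
      by_contra hP0
      have hh0 : (C (Ideal.Quotient.mk _ h) : (MvPolynomial (Fin (varDim V)) (TBR V))) ≠ 0 := by
        rw [Ne, C_eq_zero, Ideal.Quotient.eq_zero_iff_mem, tb_mem_van]
        intro h1
        exact hhp (h1 p hp)
      have : Algebra.FiniteType K (MvPolynomial (Fin (varDim V)) (TBR V)) := Algebra.FiniteType.trans (S := TBR V) inferInstance inferInstance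
      obtain ⟨φ, -, hφ⟩ := tb_pt_prime (K := K) (⊥ : Ideal (MvPolynomial (Fin (varDim V)) (TBR V))) (P * C (Ideal.Quotient.mk _ h))
        (by simpa using ⟨hP0, by simpa using hh0⟩)
      rw [map_mul] at hφ
      obtain ⟨ψ, h1, h2⟩ := tb_ext_mv (φ.comp (IsScalarTower.toAlgHom K (TBR V) (MvPolynomial (Fin (varDim V)) (TBR V))))
        (fun j => φ (X j) / φ (C (Ideal.Quotient.mk _ h)))
      have h1' : ∀ r, ψ (C r) = φ (C r) := h1
      have h3 : ∀ Q : (MvPolynomial (Fin (varDim V)) (TBR V)), ψ (θ Q) = φ Q := by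
        intro Q
        induction Q using MvPolynomial.induction_on with
        | C a => rw [hθ1, h1']
        | add a b ha hb => rw [map_add, map_add, map_add, ha, hb]
        | mul_X a j ha =>
          rw [map_mul, map_mul, map_mul, ha, hθ2, map_mul, h1', h2,
            mul_div_cancel₀ _ (right_ne_zero_of_mul hφ)]
      have h4 := h3 P
      rw [hP, map_zero] at h4
      exact left_ne_zero_of_mul hφ h4.symm
    · intro s
      induction s using MvPolynomial.induction_on with
      | C a => rw [hθ1]; exact hXr a
      | add a b ha hb => rw [map_add]; exact add_mem ha hb
      | mul_X a j ha =>
        rw [map_mul]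
        refine mul_mem ha ?_
        have h5 : θ (X j) = ∑ i, algebraMap K (MvPolynomial (Fin (varDim V)) (TBR V)) (E j i) * z (Fin.natAdd n i) := by
          rw [hθ2]
          simp only [hz2, Finset.mul_sum]
          rw [Finset.sum_comm]
          have h6 : ∀ j', ∑ i, algebraMap K (MvPolynomial (Fin (varDim V)) (TBR V)) (E j i) * (C (Ideal.Quotient.mk _ (B i j')) * X j') =
            C (if j = j' then Ideal.Quotient.mk _ h else 0) * X j' := by
            intro j'
            simp only [← mul_assoc, ← Finset.sum_mul]
            congr 1
            have h7 : ∀ i, algebraMap K (MvPolynomial (Fin (varDim V)) (TBR V)) (E j i) = C (Ideal.Quotient.mk _ (C (E j i))) :=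
              fun i => rfl
            simp only [h7, ← map_mul, ← map_sum]
            congr 1
            rw [← sub_eq_zero, ← map_zero (Ideal.Quotient.mk (vanishingIdeal K V))]
            have h8 : (if j = j' then Ideal.Quotient.mk (vanishingIdeal K V) h else
                Ideal.Quotient.mk (vanishingIdeal K V) 0) =
              Ideal.Quotient.mk (vanishingIdeal K V) (if j = j' then h else 0) := by
              split_ifs <;> rfl
            rw [h8, ← map_sub, map_zero, Ideal.Quotient.eq_zero_iff_mem, tb_mem_van]
            apply tb_irr hV ⟨p, hp, hhp⟩
            intro x hx hx0
            have h9 := ((hfr x hx hx0).2 (fun k => if j' = k then 1 else 0)).2 j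
            simp only [mul_ite, mul_one, mul_zero, Finset.sum_ite_eq, Finset.mem_univ,
              if_true] at h9
            simp only [map_sub, map_sum, map_mul, eval_C, h9, sub_eq_zero]
            by_cases hj : j = j'
            · simp [hj]
            · simp [hj, Ne.symm hj]
          refine Eq.trans ?_ (Finset.sum_congr rfl fun j' _ => (h6 j').symm)
          rw [Finset.sum_eq_single j]
          · simp
          · intro j' _ hj
            simp [Ne.symm hj]
          · simp
        rw [h5]
        refine sum_mem fun i _ => mul_mem (Subalgebra.algebraMap_mem _ _) ?_
        exact ⟨X (Fin.natAdd n i), by simp⟩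


lemma tb_nonempty {K : Type} [Field K] {n : ℕ} {V : Set (Fin n → K)}
    (hV : IsIrreducibleVariety V) : V.Nonempty := by
  by_contra h
  rw [Set.not_nonempty_iff_eq_empty] at h
  apply hV.2.ne_top
  rw [Ideal.eq_top_iff_one, tb_mem_van]
  simp [h]

lemma tb_adT {K : Type} [Field K] [IsAlgClosed K] {n : ℕ} {V : Set (Fin n → K)}
    (hV : IsIrreducibleVariety V) (hs : IsSmoothVariety V) :
    TBAD (TBcyl (tangentBundle V)) (varDim V + varDim V + 1) := by
  have := hV.2
  have : IsDomain (TBR V) := Ideal.Quotient.isDomain _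
  have hc := fun p : V => tb_chart hV hs p.1 p.2
  choose h z h1 h2 h3 h4 using hc
  have htop : Ideal.span (Set.range fun p : V => Ideal.Quotient.mk (vanishingIdeal K V) (h p)) = ⊤ := by
    by_contra hne
    obtain ⟨φ, hφ⟩ := tb_pt_ne_top (K := K) _ hne
    have hx := tb_pt_mem hV.1 φ
    have h5 := hφ _ (Ideal.subset_span ⟨⟨_, hx⟩, rfl⟩)
    rw [tb_pt_eval] at h5
    exact h1 ⟨_, hx⟩ h5
  obtain ⟨t, ht, ht2⟩ := (Ideal.span_eq_top_iff_finite _).mp htop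
  refine tb_ad3 t (fun r => TBcyl {w ∈ tangentBundle V | ∃ p : V,
    Ideal.Quotient.mk (vanishingIdeal K V) (h p) = r ∧ eval (fstProj w) (h p) ≠ 0}) ?_ _ ?_
  · intro r hr
    obtain ⟨p, hp⟩ := ht hr
    refine tb_ad1c (S := MvPolynomial (Fin (varDim V)) (TBR V)) (k := varDim V + varDim V) ?_ (z p) _ ?_
    · rw [tb_trdeg_mv (tb_trdeg hV), Fintype.card_fin]
    · rintro w ⟨hw, p', hp', hw0⟩
      apply h2 p w hw
      obtain ⟨φ, hφ⟩ := tb_pt_of_mem _ hw.1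
      rw [← hφ] at hw0 ⊢
      rw [hp', ← hp] at hw0
      exact hw0
  · intro w hw
    have hw' : (fun i => w (some i)) ∈ tangentBundle V := hw
    obtain ⟨φ, hφ⟩ := tb_pt_of_mem _ hw'.1
    by_contra hcon
    push Not at hcon
    have h6 : Ideal.span (t : Set (TBR V)) ≤ RingHom.ker φ := by
      rw [Ideal.span_le]
      intro r hr
      obtain ⟨p, hp⟩ := ht hr
      by_contra hr0
      refine hcon r hr ⟨hw', p, hp, ?_⟩
      rw [← hφ, show Ideal.Quotient.mk (vanishingIdeal K V) (h p) = r from hp]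
      exact hr0
    rw [ht2, top_le_iff, Ideal.eq_top_iff_one, RingHom.mem_ker, map_one] at h6
    exact one_ne_zero h6

/-- lower bound for the dimension -/
lemma tb_dim_low {K S : Type} [Field K] [IsAlgClosed K] {n k : ℕ} (Y : Set (Fin n → K))
    [CommRing S] [IsDomain S] [Algebra K S] [Algebra.FiniteType K S]
    (hk : Algebra.trdeg K S = (k : Cardinal)) (z : Fin n → S)
    (hz : ∀ φ : S →ₐ[K] K, (fun i => φ (z i)) ∈ Y) (θ : S →ₐ[K] S) (hθ : Function.Injective θ)
    (hθr : ∀ s, θ s ∈ (aeval (R := K) z).range) :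
    (k : WithBot ℕ∞) ≤ ringKrullDim (TBR Y) ∧ Nontrivial (TBR Y) := by
  let A := (aeval (R := K) z).range
  have hkill : ∀ q ∈ vanishingIdeal K Y, aeval z q = 0 := by
    intro q hq
    by_contra h0
    obtain ⟨φ, -, hφ⟩ := tb_pt_prime (K := K) ⊥ (aeval z q) (by simpa using h0)
    rw [tb_ev] at hφ
    exact hφ (tb_mem_van.mp hq _ (hz φ))
  let π : TBR Y →ₐ[K] A := Ideal.Quotient.liftₐ _ (aeval (R := K) z).rangeRestrict
    (fun q hq => Subtype.ext (hkill q hq))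
  have hπ : Function.Surjective π := by
    intro a
    obtain ⟨q, hq⟩ := (aeval (R := K) z).rangeRestrict_surjective a
    exact ⟨Ideal.Quotient.mk _ q, by rw [← hq]; rfl⟩
  have hFA : Algebra.FiniteType K A := Algebra.FiniteType.of_surjective
    (aeval (R := K) z).rangeRestrict (aeval (R := K) z).rangeRestrict_surjective
  obtain ⟨N, hN1, hN2, -⟩ := tb_L2 K A
  have hlow : (k : Cardinal) ≤ N := by
    rw [← hN1, ← hk]
    let θ' : S →ₐ[K] A := θ.codRestrict A hθr
    have hθ' : Function.Injective θ' := fun a b hab => hθ (congrArg Subtype.val hab)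
    exact trdeg_le_of_injective θ' hθ'
  have hlow' : k ≤ N := by exact_mod_cast hlow
  refine ⟨?_, π.toRingHom.domain_nontrivial⟩
  have h1 : ringKrullDim A ≤ ringKrullDim (TBR Y) := ringKrullDim_le_of_surjective π.toRingHom hπ
  rw [hN2] at h1
  exact le_trans (by exact_mod_cast hlow') h1

lemma tb_dim_up {K : Type} [Field K] {n k : ℕ} (Y : Set (Fin n → K))
    (had : TBAD Y k) [Nontrivial (TBR Y)] : ringKrullDim (TBR Y) ≤ (k : WithBot ℕ∞) := by
  obtain ⟨s, g, hg1, hg2, hg3⟩ := tb_dimfg (K := K) (R := TBR Y)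
  have hs2 : s ≤ k := by
    by_contra hlt
    push Not at hlt
    have h6 : ∀ i, ∃ q, Ideal.Quotient.mk (vanishingIdeal K Y) q = g (X i) :=
      fun i => Ideal.Quotient.mk_surjective _
    choose F hF using h6
    obtain ⟨P, hP0, hP⟩ := had (Fin s) (by simpa using hlt) F
    apply hP0
    apply hg1
    rw [map_zero]
    have h7 : g = (Ideal.Quotient.mkₐ K _).comp (aeval F) := by
      ext i : 1
      simp [hF]
    rw [h7]
    change Ideal.Quotient.mk _ (aeval F P) = 0
    rw [Ideal.Quotient.eq_zero_iff_mem, tb_mem_van]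
    intro y hy
    rw [← hP y hy]
    have := tb_ev (aeval (R := K) y) F P
    simpa [MvPolynomial.aeval_eq_eval] using this
  exact hg3.trans (by exact_mod_cast hs2)

lemma tb_varDim_eq {K : Type} [Field K] {n k : ℕ} (Y : Set (Fin n → K))
    (h : ringKrullDim (TBR Y) = (k : WithBot ℕ∞)) : varDim Y = k := by
  rw [varDim, h]
  rfl

lemma tb_dimT {K : Type} [Field K] [IsAlgClosed K] {n : ℕ} {V : Set (Fin n → K)}
    (hV : IsIrreducibleVariety V) (hs : IsSmoothVariety V) :
    varDim (tangentBundle V) = varDim V + varDim V := by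
  have := hV.2
  have : IsDomain (TBR V) := Ideal.Quotient.isDomain _
  have had := tb_ad4 _ (tb_adT hV hs)
  obtain ⟨p, hp⟩ := tb_nonempty hV
  obtain ⟨h, z, hh, -, hz, θ, hθ, hθr⟩ := tb_chart hV hs p hp
  have hFT : Algebra.FiniteType K (MvPolynomial (Fin (varDim V)) (TBR V)) :=
    Algebra.FiniteType.trans (S := TBR V) inferInstance inferInstance
  have htr := tb_trdeg_mv (τ := Fin (varDim V)) (tb_trdeg hV)
  rw [Fintype.card_fin] at htr
  obtain ⟨hkd, hnt⟩ := tb_dim_low (S := MvPolynomial (Fin (varDim V)) (TBR V))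
    (tangentBundle V) htr z hz θ hθ hθr
  exact tb_varDim_eq _ (le_antisymm (tb_dim_up _ had) hkd)


/-- the point of an algebra homomorphism -/
noncomputable def TBev {K : Type} [Field K] {n : ℕ} {V : Set (Fin n → K)} (φ : TBR V →ₐ[K] K) : Fin n → K :=
  fun i => φ (Ideal.Quotient.mk _ (X i))

lemma tb_ev_inj {K : Type} [Field K] {n : ℕ} {V : Set (Fin n → K)} :
    Function.Injective (TBev : (TBR V →ₐ[K] K) → (Fin n → K)) := by
  intro φ ψ h
  ext r
  obtain ⟨p, rfl⟩ := Ideal.Quotient.mk_surjective r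
  rw [tb_pt_eval, tb_pt_eval]
  exact congrArg (fun x => eval x p) h

lemma tb_pts {K ι : Type} [Field K] {n : ℕ} {V : Set (Fin n → K)} (hV : IsAlgebraicSet V)
    (F : ι → MvPolynomial (Fin n) K) (b : ι → K) :
    {x ∈ V | ∀ i, eval x (F i) = b i} =
      TBev '' {φ : TBR V →ₐ[K] K | ∀ i, φ (Ideal.Quotient.mk _ (F i)) = b i} := by
  ext x
  constructor
  · rintro ⟨hx, h⟩
    obtain ⟨φ, hφ⟩ := tb_pt_of_mem x hx
    refine ⟨φ, fun i => by rw [hφ, h], ?_⟩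
    ext i
    simp [TBev, hφ]
  · rintro ⟨φ, hφ, rfl⟩
    refine ⟨tb_pt_mem hV φ, fun i => ?_⟩
    rw [← hφ i, tb_pt_eval]
    rfl

lemma tb_pts_fin {K ι : Type} [Field K] {n : ℕ} {V : Set (Fin n → K)} (hV : IsAlgebraicSet V)
    (F : ι → MvPolynomial (Fin n) K) (b : ι → K) :
    {x ∈ V | ∀ i, eval x (F i) = b i}.Finite ↔
      {φ : TBR V →ₐ[K] K | ∀ i, φ (Ideal.Quotient.mk _ (F i)) = b i}.Finite := by
  rw [tb_pts hV, Set.finite_image_iff tb_ev_inj.injOn]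

lemma tb_pts_card {K ι : Type} [Field K] {n : ℕ} {V : Set (Fin n → K)} (hV : IsAlgebraicSet V)
    (F : ι → MvPolynomial (Fin n) K) (b : ι → K) :
    {x ∈ V | ∀ i, eval x (F i) = b i}.ncard =
      {φ : TBR V →ₐ[K] K | ∀ i, φ (Ideal.Quotient.mk _ (F i)) = b i}.ncard := by
  rw [tb_pts hV, Set.ncard_image_of_injective _ tb_ev_inj]

lemma tb_linpoly {K ι : Type} [Field K] {n : ℕ} (c : (Fin n → K) →ₗ[K] (ι → K)) :
    ∃ F : ι → MvPolynomial (Fin n) K, ∀ x i, eval x (F i) = c x i := by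
  refine ⟨fun i => ∑ j, C (c (Pi.single j 1) i) * X j, fun x i => ?_⟩
  have := tb_dot ((LinearMap.proj i).comp c) x
  simp only [map_sum, map_mul, eval_C, eval_X]
  exact this.symm

lemma tb_L_form {K : Type} [Field K] {n d : ℕ} (L : AffineSubspace K (Fin n → K))
    (hd : d ≤ n) (hL : Module.finrank K L.direction = n - d) (x0 : Fin n → K) (hx0 : x0 ∈ L) :
    ∃ c : (Fin n → K) →ₗ[K] (Fin d → K), Function.Surjective c ∧ ∀ x, x ∈ L ↔ c x = c x0 := by
  obtain ⟨c, hc, hc0⟩ := tb_surj L.direction d (by simp; omega)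
  refine ⟨c, hc, fun x => ?_⟩
  have hle : L.direction ≤ LinearMap.ker c := fun y hy => hc0 y hy
  have hr := c.finrank_range_add_finrank_ker
  rw [LinearMap.range_eq_top.mpr hc, finrank_top] at hr
  simp at hr
  have heq : L.direction = LinearMap.ker c := Submodule.eq_of_le_of_finrank_eq hle (by omega)
  rw [← sub_eq_zero, ← map_sub, ← LinearMap.mem_ker, ← heq, ← vsub_eq_sub,
    AffineSubspace.vsub_right_mem_direction_iff_mem hx0]

lemma tb_L_of {K : Type} [Field K] {n d : ℕ} (c : (Fin n → K) →ₗ[K] (Fin d → K))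
    (hc : Function.Surjective c) (a : Fin d → K) :
    ∃ L : AffineSubspace K (Fin n → K), Module.finrank K L.direction = n - d ∧
      ∀ x, x ∈ L ↔ c x = a := by
  obtain ⟨x0, rfl⟩ := hc a
  refine ⟨AffineSubspace.mk' x0 (LinearMap.ker c), ?_, fun x => ?_⟩
  · rw [AffineSubspace.direction_mk']
    have hr := c.finrank_range_add_finrank_ker
    rw [LinearMap.range_eq_top.mpr hc, finrank_top] at hr
    simp at hr
    omega
  · rw [AffineSubspace.mem_mk', vsub_eq_sub, LinearMap.mem_ker, map_sub, sub_eq_zero]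

lemma tb_bound {K : Type} [Field K] [IsAlgClosed K] [CharZero K] {n : ℕ} {V : Set (Fin n → K)}
    (hV : IsIrreducibleVariety V) (hd : varDim V ≤ n) :
    ∃ D : ℕ, ∀ L : AffineSubspace K (Fin n → K), Module.finrank K L.direction = n - varDim V →
      (V ∩ (L : Set (Fin n → K))).Finite → (V ∩ (L : Set (Fin n → K))).ncard ≤ D := by
  have := hV.2
  have : IsDomain (TBR V) := Ideal.Quotient.isDomain _
  have htr := tb_trdeg_mv (τ := Fin (varDim V) × Fin n) (tb_trdeg hV)
  have hFT : Algebra.FiniteType K (MvPolynomial (Fin (varDim V) × Fin n) (TBR V)) :=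
    Algebra.FiniteType.trans (S := TBR V) inferInstance inferInstance
  obtain ⟨D, hD⟩ := tb_Fa (R := MvPolynomial (Fin (varDim V) × Fin n) (TBR V))
    (ι := Fin (varDim V) ⊕ Fin (varDim V) × Fin n) (by rw [htr]; simp)
    (Sum.elim (fun i => ∑ j, X (i, j) * C (Ideal.Quotient.mk _ (X j))) X)
  refine ⟨D, fun L hL hfin => ?_⟩
  rcases Set.eq_empty_or_nonempty (V ∩ (L : Set (Fin n → K))) with h | ⟨x0, hx0, hx0L⟩
  · rw [h]; simp
  obtain ⟨c, hc, hcL⟩ := tb_L_form L hd hL x0 hx0L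
  have hb := hD (Sum.elim (c x0) (fun k => c (Pi.single k.2 1) k.1))
  set P := {φ : MvPolynomial (Fin (varDim V) × Fin n) (TBR V) →ₐ[K] K | ∀ i,
    φ (Sum.elim (fun i => ∑ j, X (i, j) * C (Ideal.Quotient.mk _ (X j))) X i) =
      Sum.elim (c x0) (fun k => c (Pi.single k.2 1) k.1) i} with hP
  have hcx : ∀ x i, c x i = ∑ j, c (Pi.single j 1) i * x j := fun x i =>
    tb_dot ((LinearMap.proj i).comp c) x
  let ev : (MvPolynomial (Fin (varDim V) × Fin n) (TBR V) →ₐ[K] K) → (Fin n → K) :=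
    fun φ i => φ (C (Ideal.Quotient.mk _ (X i)))
  have hinj : Set.InjOn ev P := by
    intro φ hφ ψ hψ h
    have h1 : ∀ r, φ (C r) = ψ (C r) := by
      intro r
      have h2 : φ.comp (IsScalarTower.toAlgHom K (TBR V) _) =
          ψ.comp (IsScalarTower.toAlgHom K (TBR V) _) := tb_ev_inj h
      exact congrArg (fun f : TBR V →ₐ[K] K => f r) h2
    have h3 : ∀ k, φ (X k) = ψ (X k) := fun k => (hφ (Sum.inr k)).trans (hψ (Sum.inr k)).symm
    apply AlgHom.ext
    intro Q
    induction Q using MvPolynomial.induction_on with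
    | C a => exact h1 a
    | add a b ha hb => rw [map_add, map_add, ha, hb]
    | mul_X a j ha => rw [map_mul, map_mul, ha, h3]
  have himg : ev '' P = V ∩ (L : Set (Fin n → K)) := by
    ext x
    constructor
    · rintro ⟨φ, hφ, rfl⟩
      refine ⟨tb_pt_mem hV.1 (φ.comp (IsScalarTower.toAlgHom K (TBR V) _)), ?_⟩
      change ev φ ∈ L
      rw [hcL]
      ext i
      have h1 := hφ (Sum.inl i)
      have h3 : ∀ k, φ (X k) = c (Pi.single k.2 1) k.1 := fun k => hφ (Sum.inr k)
      simp only [Sum.elim_inl, map_sum, map_mul, h3] at h1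
      rw [← h1, hcx]
    · rintro ⟨hx, hxL⟩
      obtain ⟨φ, hφ⟩ := tb_pt_of_mem x hx
      obtain ⟨ψ, h1, h2⟩ := tb_ext_mv φ
        (fun k : Fin (varDim V) × Fin n => c (Pi.single k.2 1) k.1)
      refine ⟨ψ, ?_, ?_⟩
      · rintro (i | k)
        · have h4 := congrFun ((hcL x).mp hxL) i
          simp only [Sum.elim_inl, map_sum, map_mul, h1, h2, hφ, eval_X]
          rw [← h4, hcx]
        · exact h2 k
      · ext i
        simp [ev, h1, hφ]
  rw [← himg] at hfin ⊢
  rw [hinj.ncard_image]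
  exact hb (Set.Finite.of_finite_image hfin hinj)


lemma tb_deg {K : Type} [Field K] [IsAlgClosed K] [CharZero K] {n : ℕ} {V : Set (Fin n → K)}
    (hV : IsIrreducibleVariety V) (hd : varDim V ≤ n) :
    1 ≤ geomDegree V ∧ ∃ (c : (Fin n → K) →ₗ[K] (Fin (varDim V) → K))
      (F : Fin (varDim V) → MvPolynomial (Fin n) K) (g : MvPolynomial (Fin (varDim V)) K)
      (a : Fin (varDim V) → K),
      Function.Surjective c ∧ (∀ x i, eval x (F i) = c x i) ∧ eval a g ≠ 0 ∧
      {x ∈ V | c x = a}.Finite ∧ {x ∈ V | c x = a}.ncard = geomDegree V ∧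
      AlgebraicIndependent K (fun i => (Ideal.Quotient.mk (vanishingIdeal K V) (F i))) ∧
      ∀ r : TBR V, ∃ k : ℕ, (aeval (R := K)
        (fun i => (Ideal.Quotient.mk (vanishingIdeal K V) (F i)))).toRingHom.IsIntegralElem
          (aeval (fun i => (Ideal.Quotient.mk (vanishingIdeal K V) (F i))) g ^ k * r) := by
  have := hV.2
  have : IsDomain (TBR V) := Ideal.Quotient.isDomain _
  obtain ⟨D, hD⟩ := tb_bound hV hd
  have hbdd : BddAbove {m | ∃ L : AffineSubspace K (Fin n → K),
    Module.finrank K L.direction = n - varDim V ∧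
    (V ∩ (L : Set (Fin n → K))).Finite ∧ (V ∩ (L : Set (Fin n → K))).ncard = m} := by
    refine ⟨D, ?_⟩
    rintro m ⟨L, h1, h2, rfl⟩
    exact hD L h1 h2
  obtain ⟨x0, hx0⟩ := tb_nonempty hV
  have hone : ∃ m, 1 ≤ m ∧ m ∈ {m | ∃ L : AffineSubspace K (Fin n → K),
    Module.finrank K L.direction = n - varDim V ∧
    (V ∩ (L : Set (Fin n → K))).Finite ∧ (V ∩ (L : Set (Fin n → K))).ncard = m} := by
    obtain ⟨W', -, hW', hfin⟩ := tb_H V (tb_adV hV) (fun i => X i - C (x0 i)) (n - varDim V) ⊥ (by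
      refine (Set.finite_singleton x0).subset ?_
      rintro x ⟨-, hx⟩
      rw [Submodule.mem_bot] at hx
      ext i
      have := congrFun hx i
      simpa [sub_eq_zero] using this) (by simp)
    have heq : V ∩ (AffineSubspace.mk' x0 W' : Set (Fin n → K)) =
        {x ∈ V | (fun i => eval x (X i - C (x0 i))) ∈ W'} := by
      ext x
      have h1 : (fun i => eval x (X i - C (x0 i))) = x - x0 := by ext i; simp
      simp only [Set.mem_inter_iff, SetLike.mem_coe, AffineSubspace.mem_mk', vsub_eq_sub]
      rw [← h1]
      rfl
    rw [← heq] at hfin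
    refine ⟨_, ?_, AffineSubspace.mk' x0 W', ?_, hfin, rfl⟩
    · rw [Nat.one_le_iff_ne_zero, Ne, Set.ncard_eq_zero hfin, ← Ne, ← Set.nonempty_iff_ne_empty]
      exact ⟨x0, hx0, AffineSubspace.self_mem_mk' _ _⟩
    · rw [AffineSubspace.direction_mk', hW', Fintype.card_fin]
  obtain ⟨m, hm1, hm⟩ := hone
  have hdeg1 : 1 ≤ geomDegree V := hm1.trans (le_csSup hbdd hm)
  refine ⟨hdeg1, ?_⟩
  obtain ⟨L, hL1, hL2, hL3⟩ : geomDegree V ∈ {m | ∃ L : AffineSubspace K (Fin n → K),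
    Module.finrank K L.direction = n - varDim V ∧
    (V ∩ (L : Set (Fin n → K))).Finite ∧ (V ∩ (L : Set (Fin n → K))).ncard = m} :=
    Nat.sSup_mem ⟨m, hm⟩ hbdd
  have hne : (V ∩ (L : Set (Fin n → K))).Nonempty := by
    rw [← Set.ncard_pos hL2]
    omega
  obtain ⟨x1, hx1, hx1L⟩ := hne
  obtain ⟨c, hc, hcL⟩ := tb_L_form L hd hL1 x1 hx1L
  obtain ⟨F, hF⟩ := tb_linpoly c
  have hset : ∀ a, {x ∈ V | c x = a} = {x ∈ V | ∀ i, eval x (F i) = a i} := by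
    intro a
    ext x
    simp only [hF, Set.mem_ofPred_eq, funext_iff]
  have hVL : V ∩ (L : Set (Fin n → K)) = {x ∈ V | c x = c x1} := by
    ext x
    exact and_congr_right fun _ => hcL x
  rw [hVL] at hL2 hL3
  have htr : Algebra.trdeg K (TBR V) = (Fintype.card (Fin (varDim V)) : Cardinal) := by
    rw [tb_trdeg hV]; simp
  have hL2' := hL2
  rw [hset, tb_pts_fin hV.1] at hL2'
  obtain ⟨φ1, hφ1⟩ := tb_pt_of_mem x1 hx1
  have hind := tb_indep htr _ _ hL2' φ1 (fun i => by rw [hφ1, hF])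
  obtain ⟨D', hD1, hD2, g, hg0, hg, G, hG0, hG⟩ := tb_F htr _ hind
  obtain ⟨a, ha⟩ := tb_exists_eval G hG0
  obtain ⟨h1, h2, h3⟩ := hG a ha
  have hle1 : geomDegree V ≤ D' := by
    rw [← hL3, hset, tb_pts_card hV.1]
    exact hD2 _ hL2'
  rw [← tb_pts_fin hV.1, ← hset] at h2
  rw [← tb_pts_card hV.1, ← hset] at h3
  have hle2 : D' ≤ geomDegree V := by
    obtain ⟨L', hL'1, hL'2⟩ := tb_L_of c hc a
    refine le_csSup hbdd ⟨L', hL'1, ?_⟩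
    have : V ∩ (L' : Set (Fin n → K)) = {x ∈ V | c x = a} := by
      ext x
      exact and_congr_right fun _ => hL'2 x
    rw [this]
    exact ⟨h2, h3⟩
  exact ⟨c, F, g, a, hc, hF, h1, h2, by omega, hind, hg⟩


/-- directional derivative -/
noncomputable def TBdir {K : Type} [Field K] {n : ℕ} (v : Fin n → K)
    (φ : MvPolynomial (Fin n) K) : MvPolynomial (Fin n) K := ∑ i, pderiv i φ * C (v i)

lemma tb_dir_eval {K : Type} [Field K] {n : ℕ} (v x : Fin n → K)
    (φ : MvPolynomial (Fin n) K) : eval x (TBdir v φ) = ∑ i, eval x (pderiv i φ) * v i := by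
  simp [TBdir]

lemma tb_dir_line {K : Type} [Field K] {n : ℕ} (v x : Fin n → K) (φ : MvPolynomial (Fin n) K) :
    Polynomial.derivative (aeval (fun i => Polynomial.C (x i) + Polynomial.C (v i) * Polynomial.X) φ) =
      aeval (fun i => Polynomial.C (x i) + Polynomial.C (v i) * Polynomial.X) (TBdir v φ) := by
  induction φ using MvPolynomial.induction_on with
  | C a => simp [TBdir]
  | add p q hp hq =>
    have : TBdir v (p + q) = TBdir v p + TBdir v q := by
      simp [TBdir, add_mul, Finset.sum_add_distrib]
    rw [map_add, Polynomial.derivative_add, hp, hq, this, map_add]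
  | mul_X p i hp =>
    have h1 : TBdir v (p * X i) = TBdir v p * X i + p * C (v i) := by
      simp only [TBdir, pderiv_mul, add_mul, Finset.sum_add_distrib, Finset.sum_mul]
      congr 1
      · exact Finset.sum_congr rfl fun j _ => by ring
      · rw [Finset.sum_eq_single i]
        · simp
        · intro j _ hj
          rw [pderiv_X_of_ne hj.symm]
          simp
        · simp
    rw [h1, map_mul, Polynomial.derivative_mul, hp, map_add, map_mul, map_mul, aeval_X,
      MvPolynomial.aeval_C]
    simp

lemma tb_line_eval {K : Type} [Field K] {n : ℕ} (v x : Fin n → K) (φ : MvPolynomial (Fin n) K)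
    (t : K) : (aeval (fun i => Polynomial.C (x i) + Polynomial.C (v i) * Polynomial.X) φ :
      Polynomial K).eval t = eval (fun i => x i + v i * t) φ := by
  have h := tb_ev (Polynomial.aeval (R := K) t)
    (fun i => Polynomial.C (x i) + Polynomial.C (v i) * Polynomial.X) φ
  simpa using h

lemma tb_taylor {K : Type} [Field K] [CharZero K] {n : ℕ} {V : Set (Fin n → K)} (v : Fin n → K)
    (hv : ∀ φ ∈ vanishingIdeal K V, TBdir v φ ∈ vanishingIdeal K V) (x : Fin n → K) (hx : x ∈ V) :
    ∀ (N : ℕ), ∀ φ ∈ vanishingIdeal K V,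
      (aeval (fun i => Polynomial.C (x i) + Polynomial.C (v i) * Polynomial.X) φ :
        Polynomial K).natDegree ≤ N →
      (aeval (fun i => Polynomial.C (x i) + Polynomial.C (v i) * Polynomial.X) φ :
        Polynomial K) = 0 := by
  intro N
  have hbase : ∀ φ ∈ vanishingIdeal K V,
      (aeval (fun i => Polynomial.C (x i) + Polynomial.C (v i) * Polynomial.X) φ :
        Polynomial K).natDegree = 0 →
      (aeval (fun i => Polynomial.C (x i) + Polynomial.C (v i) * Polynomial.X) φ :
        Polynomial K) = 0 := by
    intro φ hφ h
    have h1 := tb_line_eval v x φ 0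
    have h2 : eval (fun i => x i + v i * 0) φ = 0 := by
      simpa using tb_mem_van.mp hφ x hx
    rw [h2] at h1
    rw [Polynomial.eq_C_of_natDegree_eq_zero h] at h1 ⊢
    simp at h1
    rw [h1, map_zero]
  induction N with
  | zero => intro φ hφ h; exact hbase φ hφ (by omega)
  | succ N ih =>
    intro φ hφ h
    have h1 := ih (TBdir v φ) (hv φ hφ) (by
      rw [← tb_dir_line]
      refine (Polynomial.natDegree_derivative_le _).trans ?_
      omega)
    rw [← tb_dir_line] at h1
    exact hbase φ hφ (Polynomial.derivative_eq_zero.mp h1)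

lemma tb_translate {K : Type} [Field K] [CharZero K] {n : ℕ} {V : Set (Fin n → K)}
    (hV : IsAlgebraicSet V) (T0 : Submodule K (Fin n → K)) (hT : ∀ x ∈ V, T0 ≤ TBT V x)
    (x : Fin n → K) (hx : x ∈ V) (v : Fin n → K) (hv : v ∈ T0) : x + v ∈ V := by
  apply tb_alg_mem hV
  intro φ hφ
  have h0 := tb_taylor v (V := V) (fun φ hφ => by
    rw [tb_mem_van]
    intro y hy
    rw [tb_dir_eval]
    exact hT y hy hv φ hφ) x hx _ φ hφ le_rfl
  have h1 := tb_line_eval v x φ 1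
  rw [h0, Polynomial.eval_zero] at h1
  rw [h1]
  congr 1
  simp
  rfl

lemma tb_const {K : Type} [Field K] [IsAlgClosed K] [CharZero K] {n : ℕ} {V : Set (Fin n → K)}
    (hV : IsIrreducibleVariety V) (T0 : Submodule K (Fin n → K))
    (hd : Module.finrank K T0 = varDim V) (hT : ∀ x ∈ V, T0 ≤ TBT V x) : IsLinearVariety V := by
  classical
  obtain ⟨x0, hx0⟩ := tb_nonempty hV
  refine ⟨AffineSubspace.mk' x0 T0, ?_⟩
  ext x1
  rw [SetLike.mem_coe, AffineSubspace.mem_mk', vsub_eq_sub]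
  constructor
  swap
  · intro h
    have := tb_translate hV.1 T0 hT x0 hx0 _ h
    simpa using this
  intro hx1
  by_contra hcon
  obtain ⟨ω, hω1, hω2⟩ := Submodule.exists_dual_map_eq_bot_of_notMem hcon inferInstance
  have hω3 : ∀ v ∈ T0, ω v = 0 := by
    intro v hv
    rw [← Submodule.mem_bot K, ← hω2]
    exact Submodule.mem_map_of_mem hv
  have h00 := tb_frame0 T0
  rw [hd] at h00
  obtain ⟨E, -, hE⟩ := h00
  let l : (Fin n → K) →ₗ[K] (Fin (varDim V) → K) :=
    LinearMap.pi fun j => ∑ i, E j i • LinearMap.proj i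
  have hl : ∀ y j, l y j = ∑ i, E j i * y i := fun y j => by simp [l]
  have hinj : Function.Injective (l.comp T0.subtype) := by
    rw [← LinearMap.ker_eq_bot, LinearMap.ker_eq_bot']
    intro y hy
    ext1
    apply hE y y.2
    intro j
    rw [← hl]
    exact congrFun hy j
  have hsurj : Function.Surjective (l.comp T0.subtype) :=
    (LinearMap.injective_iff_surjective_of_finrank_eq_finrank (by rw [hd]; simp)).mp hinj
  let c : (Fin n → K) →ₗ[K] (Option (Fin (varDim V)) → K) :=
    LinearMap.pi fun o => o.elim ω (fun j => (LinearMap.proj j).comp l)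
  have hc : ∀ y, c y = fun o : Option (Fin (varDim V)) => o.elim (ω y) (l y) := by
    intro y
    ext o
    cases o <;> rfl
  obtain ⟨F, hF⟩ := tb_linpoly c
  obtain ⟨P, hP0, hP⟩ := tb_ad4 V (tb_adV hV) _ (by simp) F
  obtain ⟨w, hw⟩ := tb_exists_eval P hP0
  have hw' : w = fun o : Option (Fin (varDim V)) => o.elim (w none) (fun j => w (some j)) := by
    ext o; cases o <;> rfl
  set q := (optionEquivLeft K _ P).map (eval (fun j => w (some j))) with hq
  have hq0 : q ≠ 0 := by
    intro h
    rw [hw', tb_opt_eval, ← hq, h, Polynomial.eval_zero] at hw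
    exact hw rfl
  have hroot : ∀ x ∈ V, q.eval (ω x) = 0 := by
    intro x hx
    obtain ⟨v, hv⟩ := hsurj (fun j => w (some j) - l x j)
    have hxv := tb_translate hV.1 T0 hT x hx v v.2
    have h1 := hP _ hxv
    have h2 : (fun i => eval (x + (v : Fin n → K)) (F i)) =
        fun o : Option (Fin (varDim V)) => o.elim (ω x) (fun j => w (some j)) := by
      ext o
      rw [hF, hc, map_add, map_add, hω3 v v.2, add_zero]
      have h3 : l v = fun j => w (some j) - l x j := hv
      cases o with
      | none => rfl
      | some j => simp [h3]
    rw [h2, tb_opt_eval] at h1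
    exact h1
  obtain ⟨ωp, hωp⟩ := tb_linpoly (LinearMap.pi fun _ : Unit => ω)
  have hprod : ∏ r ∈ q.roots.toFinset, (ωp () - C r) ∈ vanishingIdeal K V := by
    rw [tb_mem_van]
    intro x hx
    rw [map_prod]
    apply Finset.prod_eq_zero (i := ω x)
    · simp [hq0, hroot x hx]
    · simp [hωp]
  obtain ⟨r, -, hr⟩ := (Ideal.IsPrime.prod_mem_iff (hp := hV.2)).mp hprod
  rw [tb_mem_van] at hr
  have e0 := hr x0 hx0
  have e1 := hr x1 hx1
  simp [hωp, sub_eq_zero] at e0 e1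
  apply hω1
  rw [map_sub, e0, e1, sub_self]

lemma tb_newdir {K : Type} [Field K] [IsAlgClosed K] [CharZero K] {n : ℕ} {V : Set (Fin n → K)}
    (hV : IsIrreducibleVariety V) (hs : IsSmoothVariety V) (hnl : ¬ IsLinearVariety V)
    (Q : Set (Fin n → K)) (hQ : Q.Finite) (hQV : Q ⊆ V) (u : MvPolynomial (Fin n) K)
    (hu : ∃ x ∈ V, eval x u ≠ 0) :
    ∃ p ∈ V, eval p u ≠ 0 ∧ ∃ v ∈ TBT V p, ∀ q ∈ Q, v ∉ TBT V q := by
  by_contra hcon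
  push Not at hcon
  have hψ : ∀ q ∈ Q, ∃ ψ : MvPolynomial (Fin n) K, ψ ∉ vanishingIdeal K V ∧
      ∀ x, TBT V q ≤ TBT V x → eval x ψ = 0 := by
    intro q hq
    by_contra hno
    push Not at hno
    apply hnl
    refine tb_const hV (TBT V q) (tb_finrankT hs q (hQV hq)) ?_
    intro x hx v hv φ hφ
    by_contra hne
    obtain ⟨y, hy1, hy2⟩ := hno (TBdir v φ) (fun h => hne (by
      rw [← tb_dir_eval]; exact tb_mem_van.mp h x hx))
    rw [tb_dir_eval] at hy2
    exact hy2 (hy1 hv φ hφ)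
  choose! ψ hψ1 hψ2 using hψ
  have hprod : u * ∏ q ∈ hQ.toFinset, ψ q ∈ vanishingIdeal K V := by
    rw [tb_mem_van]
    intro x hx
    rw [map_mul, map_prod]
    by_cases hxu : eval x u = 0
    · rw [hxu, zero_mul]
    · have h1 := hcon x hx hxu
      have : Finite Q := hQ
      obtain ⟨q, hq⟩ := Subspace.exists_eq_top_of_iUnion_eq_univ (k := K) (E := TBT V x)
        (p := fun q : Q => (TBT V q.1).comap (TBT V x).subtype) (by
          rw [Set.eq_univ_iff_forall]
          intro v
          obtain ⟨q, hq, hv⟩ := h1 v v.2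
          exact Set.mem_iUnion.mpr ⟨⟨q, hq⟩, hv⟩)
      have hle : TBT V x ≤ TBT V q := by
        intro v hv
        have : (⟨v, hv⟩ : TBT V x) ∈ (TBT V q.1).comap (TBT V x).subtype := by
          rw [hq]; trivial
        exact this
      have heq : TBT V x = TBT V q := Submodule.eq_of_le_of_finrank_eq hle (by
        rw [tb_finrankT hs x hx, tb_finrankT hs q (hQV q.2)])
      rw [Finset.prod_eq_zero (i := (q : Fin n → K)) (by simp)
        (hψ2 q q.2 x heq.ge), mul_zero]
  rcases hV.2.mem_or_mem hprod with h | h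
  · obtain ⟨x, hx, hx0⟩ := hu
    exact hx0 (tb_mem_van.mp h x hx)
  · obtain ⟨q, hq, h2⟩ := (Ideal.IsPrime.prod_mem_iff (hp := hV.2)).mp h
    exact hψ1 q (by simpa using hq) h2


lemma tb_bind_eval {K ι σ : Type} [Field K] (F : ι → MvPolynomial σ K) (G : MvPolynomial ι K)
    (x : σ → K) : eval x (aeval F G) = eval (fun i => eval x (F i)) G := by
  have := tb_ev (aeval (R := K) x) F G
  simpa [MvPolynomial.aeval_eq_eval] using this

lemma tb_aeval_mk {K ι : Type} [Field K] {n : ℕ} {V : Set (Fin n → K)}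
    (F : ι → MvPolynomial (Fin n) K) (G : MvPolynomial ι K) :
    aeval (fun i => Ideal.Quotient.mk (vanishingIdeal K V) (F i)) G =
      Ideal.Quotient.mk (vanishingIdeal K V) (aeval F G) := by
  have h : aeval (R := K) (fun i => Ideal.Quotient.mk (vanishingIdeal K V) (F i)) =
      (Ideal.Quotient.mkₐ K (vanishingIdeal K V)).comp (aeval F) := by
    ext i : 1
    simp
  rw [h]
  rfl

lemma tb_dense {K ι : Type} [Field K] {n : ℕ} {V : Set (Fin n → K)}
    (F : ι → MvPolynomial (Fin n) K)
    (hind : AlgebraicIndependent K (fun i => Ideal.Quotient.mk (vanishingIdeal K V) (F i)))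
    (G : MvPolynomial ι K) (hG : G ≠ 0) : ∃ x ∈ V, eval (fun i => eval x (F i)) G ≠ 0 := by
  by_contra hcon
  push Not at hcon
  apply hG
  rw [algebraicIndependent_iff] at hind
  apply hind
  rw [tb_aeval_mk, Ideal.Quotient.eq_zero_iff_mem, tb_mem_van]
  intro x hx
  rw [tb_bind_eval, hcon x hx]

lemma tb_Q {K : Type} [Field K] {d : ℕ} (p : Polynomial (MvPolynomial (Fin d) K)) (hp : p.Monic)
    (g : MvPolynomial (Fin d) K) (k : ℕ) (a w : Fin d → K) (hg : eval a g ≠ 0) :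
    ∃ Q : Polynomial K, Q ≠ 0 ∧ ∀ s r' : K, s * r' = 1 →
      (p.map (eval (fun i => a i + w i * s))).eval (eval (fun i => a i + w i * s) g ^ k * r') = 0 →
      Q.eval s = 0 := by
  let lam : MvPolynomial (Fin d) K →ₐ[K] Polynomial K :=
    aeval (fun i => Polynomial.C (a i) + Polynomial.C (w i) * Polynomial.X)
  have hlam : ∀ q t, (lam q).eval t = eval (fun i => a i + w i * t) q := fun q t =>
    tb_line_eval w a q t
  refine ⟨∑ j ∈ Finset.range (p.natDegree + 1),
    lam (p.coeff j) * (lam g ^ k) ^ j * Polynomial.X ^ (p.natDegree - j), ?_, ?_⟩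
  · intro h
    have h1 := congrArg (Polynomial.eval 0) h
    rw [Polynomial.eval_finsetSum, Finset.sum_range_succ, Finset.sum_eq_zero] at h1
    · have h2 : (fun i => a i + w i * 0) = a := by simp
      rw [hp.coeff_natDegree] at h1
      simp [hlam] at h1
      exact hg h1.1.1
    · intro j hj
      rw [Finset.mem_range] at hj
      have : p.natDegree - j ≠ 0 := by omega
      simp [this]
  · intro s r' hsr h
    rw [Polynomial.eval_finsetSum]
    have h1 : (p.map (eval (fun i => a i + w i * s))).natDegree < p.natDegree + 1 :=
      Nat.lt_succ_of_le Polynomial.natDegree_map_le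
    rw [Polynomial.eval_eq_sum_range' h1] at h
    rw [← mul_zero (s ^ p.natDegree), ← h, Finset.mul_sum]
    refine Finset.sum_congr rfl fun j hj => ?_
    rw [Finset.mem_range] at hj
    have h3 : s ^ p.natDegree = s ^ (p.natDegree - j) * s ^ j := by
      rw [← pow_add]; congr 1; omega
    simp only [Polynomial.eval_mul, Polynomial.eval_pow, Polynomial.eval_X, hlam,
      Polynomial.coeff_map]
    rw [h3, mul_pow]
    have h4 : s ^ j * r' ^ j = 1 := by rw [← mul_pow, hsr, one_pow]
    linear_combination (-(eval (fun i => a i + w i * s) (p.coeff j) *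
      (eval (fun i => a i + w i * s) g ^ k) ^ j * s ^ (p.natDegree - j))) * h4

lemma tb_Sfin {K : Type} [Field K] [IsAlgClosed K] [CharZero K] {n d : ℕ} {V : Set (Fin n → K)}
    (hV : IsIrreducibleVariety V) (F : Fin d → MvPolynomial (Fin n) K)
    (g : MvPolynomial (Fin d) K) (a w : Fin d → K) (ha : eval a g ≠ 0)
    (hintegral : ∀ r : TBR V, ∃ k : ℕ, (aeval (R := K)
        (fun i => (Ideal.Quotient.mk (vanishingIdeal K V) (F i)))).toRingHom.IsIntegralElem
          (aeval (fun i => (Ideal.Quotient.mk (vanishingIdeal K V) (F i))) g ^ k * r))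
    (v : Fin n → K) (hw : w ≠ 0)
    (hv : ∀ x ∈ V, (∀ i, eval x (F i) = a i) → v ∉ TBT V x) :
    {x ∈ V | v ∈ TBT V x ∧ eval (fun i => eval x (F i)) g ≠ 0 ∧
      ∃ s, ∀ i, eval x (F i) = a i + w i * s}.Finite := by
  obtain ⟨k0, hk0⟩ := Function.ne_iff.mp hw
  rw [Pi.zero_apply] at hk0
  let sp : MvPolynomial (Fin n) K := C (w k0)⁻¹ * (F k0 - C (a k0))
  have hsp : ∀ x s, eval x (F k0) = a k0 + w k0 * s → eval x sp = s := by
    intro x s h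
    simp only [sp, map_mul, eval_C, map_sub, h]
    field_simp
    ring
  let mk := Ideal.Quotient.mk (vanishingIdeal K V)
  let A : Set (TBR V) := {r | ∃ i, r = mk (F i - C (a i) - C (w i) * sp)} ∪
    {r | ∃ φ ∈ vanishingIdeal K V, r = mk (TBdir v φ)}
  have htop : Ideal.span (insert (mk sp) A) = ⊤ := by
    by_contra hne
    obtain ⟨φ, hφ⟩ := tb_pt_ne_top (K := K) _ hne
    have hx := tb_pt_mem hV.1 φ
    have hev : ∀ q, mk q ∈ insert (mk sp) A → eval (TBev φ) q = 0 := by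
      intro q hq
      have h1 := hφ _ (Ideal.subset_span hq)
      rwa [tb_pt_eval] at h1
    have h0 : eval (TBev φ) sp = 0 := hev _ (Or.inl rfl)
    refine hv _ hx (fun i => ?_) (fun f hf => ?_)
    · have h1 := hev (F i - C (a i) - C (w i) * sp) (Or.inr (Or.inl ⟨i, rfl⟩))
      simp only [map_sub, map_mul, eval_C, h0, mul_zero, sub_zero] at h1
      exact sub_eq_zero.mp h1
    · have h1 := hev (TBdir v f) (Or.inr (Or.inr ⟨f, hf, rfl⟩))
      rw [tb_dir_eval] at h1
      exact h1
  rw [Ideal.eq_top_iff_one, Ideal.mem_span_insert] at htop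
  obtain ⟨r, z, hz, h1⟩ := htop
  obtain ⟨k, p, hp, hp0⟩ := hintegral r
  obtain ⟨Q, hQ0, hQ⟩ := tb_Q p hp g k a w ha
  classical
  refine (Set.Finite.biUnion (Q.roots.toFinset.finite_toSet) (t := fun s =>
    {x ∈ V | (∀ i, eval x (F i) = a i + w i * s) ∧ eval (fun i => a i + w i * s) g ≠ 0}) ?_).subset ?_
  · intro s _
    by_cases hs : eval (fun i => a i + w i * s) g = 0
    · refine Set.finite_empty.subset ?_
      rintro x ⟨-, -, h⟩
      exact h hs
    · have h2 := tb_fib_fin _ g hintegral (fun i => a i + w i * s) hs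
      rw [← tb_pts_fin hV.1] at h2
      refine h2.subset ?_
      rintro x ⟨hx, h, -⟩
      exact ⟨hx, h⟩
  · rintro x ⟨hx, hvx, hgx, s, hs⟩
    have hfx : (fun i => eval x (F i)) = fun i => a i + w i * s := funext hs
    rw [hfx] at hgx
    refine Set.mem_iUnion₂.mpr ⟨s, ?_, hx, hs, hgx⟩
    obtain ⟨φ, hφ⟩ := tb_pt_of_mem x hx
    have hz0 : φ z = 0 := by
      have : Ideal.span A ≤ RingHom.ker φ := by
        rw [Ideal.span_le]
        rintro r (⟨i, rfl⟩ | ⟨f, hf, rfl⟩)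
        · change φ (mk _) = 0
          rw [hφ]
          simp only [map_sub, map_mul, eval_C, hsp x s (hs k0), hs]
          ring
        · change φ (mk _) = 0
          rw [hφ, tb_dir_eval]
          exact hvx f hf
      exact this hz
    have h2 : s * φ r = 1 := by
      have h3 := congrArg φ h1
      rw [map_add, map_mul, hz0, map_one, add_zero, hφ, hsp x s (hs k0)] at h3
      rw [h3, mul_comm]
    have h4 := tb_int_root _ g r k p hp0 φ (fun i => a i + w i * s) (fun i => by rw [hφ, hs])
    have h5 := hQ s (φ r) h2 h4
    simp [hQ0, h5]


lemma tb_part1 {K : Type} [Field K] [IsAlgClosed K] [CharZero K] {n : ℕ} {V : Set (Fin n → K)}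
    (hV : IsIrreducibleVariety V) (hs : IsSmoothVariety V) (hnl : ¬ IsLinearVariety V)
    (hd : varDim V ≤ n) :
    1 ≤ geomDegree V ∧ ∃ (c : (Fin n → K) →ₗ[K] (Fin (varDim V) → K)) (a : Fin (varDim V) → K)
      (p v : Fin n → K), Function.Surjective c ∧ {x ∈ V | c x = a}.Finite ∧
      {x ∈ V | c x = a}.ncard = geomDegree V ∧ p ∈ V ∧ v ∈ TBT V p ∧
      (∀ q ∈ {x ∈ V | c x = a}, v ∉ TBT V q) ∧
      {x ∈ V | v ∈ TBT V x ∧ ∃ s : K, c x = a + s • (c p - a)}.Finite := by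
  obtain ⟨h1, c, F, g, a, hc, hF, hg, hQf, hQc, hind, hintegral⟩ := tb_deg hV hd
  refine ⟨h1, ?_⟩
  have hQne : {x ∈ V | c x = a}.Nonempty := by
    rw [← Set.ncard_pos hQf]; omega
  obtain ⟨p1, hp1, hcp1⟩ := hQne
  have hFc : ∀ x, (fun i => eval x (F i)) = c x := fun x => funext (hF x)
  have hp1' : eval p1 (aeval F g) ≠ 0 := by
    rw [tb_bind_eval, hFc, hcp1]; exact hg
  obtain ⟨G2, hG0, hG2⟩ := tb_P _ (tb_adV0 hV (aeval F g) ⟨p1, hp1, hp1'⟩)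
    (fun i => F i - C (a i)) (by simp)
  let G3 : MvPolynomial (Fin (varDim V)) K := aeval (fun i => X i - C (a i)) G2
  have hG3e : ∀ y, eval y G3 = eval (y - a) G2 := by
    intro y
    rw [show G3 = aeval (fun i => X i - C (a i)) G2 from rfl, tb_bind_eval]
    simp
    rfl
  have hG3 : G3 ≠ 0 := by
    obtain ⟨y, hy⟩ := tb_exists_eval G2 hG0
    intro h
    have := hG3e (y + a)
    rw [h, add_sub_cancel_right] at this
    exact hy (by rw [← this]; simp)
  obtain ⟨x0, hx0, hx0'⟩ := tb_dense F hind G3 hG3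
  obtain ⟨p, hp, hpu, v, hv, hvQ⟩ := tb_newdir hV hs hnl _ hQf (fun x hx => hx.1) (aeval F G3)
    ⟨x0, hx0, by rw [tb_bind_eval]; exact hx0'⟩
  rw [tb_bind_eval, hFc, hG3e] at hpu
  refine ⟨c, a, p, v, hc, hQf, hQc, hp, hv, hvQ, ?_⟩
  have hw : c p - a ≠ 0 := fun h => hvQ p ⟨hp, sub_eq_zero.mp h⟩ hv
  have hS := tb_Sfin hV F g a (c p - a) hg hintegral v hw (fun x hx hxa => hvQ x ⟨hx, by
    rw [← hFc]; exact funext hxa⟩)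
  refine (hS.union (hG2 _ hpu)).subset ?_
  rintro x ⟨hx, hvx, s, hsx⟩
  have hsi : ∀ i, eval x (F i) = a i + (c p - a) i * s := by
    intro i
    rw [hF, hsx]; simp [mul_comm]
  by_cases hgx : eval (fun i => eval x (F i)) g = 0
  · right
    refine ⟨⟨hx, by rw [tb_bind_eval]; exact hgx⟩, s⁻¹, fun i => ?_⟩
    have hs0 : s ≠ 0 := by
      rintro rfl
      exact hvQ x ⟨hx, by simpa using hsx⟩ hvx
    simp only [map_sub, eval_C, hsi]
    field_simp
    ring
  · left
    exact ⟨hx, hvx, hgx, s, hsi⟩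


lemma tb_nonlin {K : Type} [Field K] [IsAlgClosed K] [CharZero K] {n : ℕ} {V : Set (Fin n → K)}
    (hV : IsIrreducibleVariety V) (hs : IsSmoothVariety V) (hnl : ¬ IsLinearVariety V) :
    geomDegree (tangentBundle V) ≠ geomDegree V := by
  classical
  have hinf : Infinite K := inferInstance
  obtain ⟨x0, hx0⟩ := tb_nonempty hV
  have hd : varDim V ≤ n := by
    rw [← tb_finrankT hs x0 hx0]
    simpa using Submodule.finrank_le (TBT V x0)
  obtain ⟨h1, c, a, p, v, hc, hQf, hQc, hp, hv, hvQ, hS⟩ := tb_part1 hV hs hnl hd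
  obtain ⟨p1, hp1, hcp1⟩ : {x ∈ V | c x = a}.Nonempty := by
    rw [← Set.ncard_pos hQf]; omega
  have hdn : varDim V < n := by
    refine lt_of_le_of_ne hd fun h => hvQ p1 ⟨hp1, hcp1⟩ ?_
    have : TBT V p1 = ⊤ := Submodule.eq_top_of_finrank_eq (by
      rw [tb_finrankT hs p1 hp1, h]; simp)
    rw [this]; trivial
  have hv0 : v ≠ 0 := by
    rintro rfl
    exact hvQ p1 ⟨hp1, hcp1⟩ (Submodule.zero_mem _)
  have hw : c p - a ≠ 0 := fun h => hvQ p ⟨hp, sub_eq_zero.mp h⟩ hv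
  obtain ⟨k0, hk0⟩ := Function.ne_iff.mp hw
  rw [Pi.zero_apply] at hk0
  obtain ⟨F, hF⟩ := tb_linpoly c
  let f : Fin (varDim V) ⊕ Fin n → MvPolynomial (Fin (n + n)) K :=
    Sum.elim (fun i => rename (Fin.castAdd n) (F i) - C (a i)) (fun j => X (Fin.natAdd n j))
  have hf : ∀ z : Fin (n + n) → K, (fun i => eval z (f i)) =
      Sum.elim (c (fstProj z) - a) (sndProj z) := by
    intro z
    ext i
    rcases i with i | j
    · have := hF (fstProj z) i
      simp only [f, Sum.elim_inl, map_sub, eval_rename, eval_C, Pi.sub_apply]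
      rw [← this]
      rfl
    · simp [f, sndProj]
  let q0 : Fin (varDim V) ⊕ Fin n → K := Sum.elim (c p - a) v
  have hq0 : q0 ≠ 0 := fun h => hv0 (funext fun j => congrFun h (Sum.inr j))
  have hmem : ∀ z : Fin (n + n) → K, z = Fin.append (fstProj z) (sndProj z) := by
    intro z
    ext i
    refine Fin.addCases (fun i => ?_) (fun i => ?_) i
    · rw [Fin.append_left]; rfl
    · rw [Fin.append_right]; rfl
  have hfst : ∀ x y : Fin n → K, fstProj (Fin.append x y) = x := by
    intro x y; ext i; simp [fstProj]
  have hsnd : ∀ x y : Fin n → K, sndProj (Fin.append x y) = y := by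
    intro x y; ext i; exact Fin.append_right x y i
  have hfin : {z ∈ tangentBundle V | (fun i => eval z (f i)) ∈ Submodule.span K {q0}}.Finite := by
    refine ((hS.union hQf).image (fun x => Fin.append x (((c x - a) k0 / (c p - a) k0) • v))).subset ?_
    rintro z ⟨⟨hz1, hz2⟩, hz⟩
    rw [hf, Submodule.mem_span_singleton] at hz
    obtain ⟨s, hsz⟩ := hz
    have e1 : s • (c p - a) = c (fstProj z) - a := by
      ext i; exact congrFun hsz (Sum.inl i)
    have e2 : s • v = sndProj z := by
      ext i; exact congrFun hsz (Sum.inr i)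
    refine ⟨fstProj z, ?_, ?_⟩
    · by_cases hs0 : s = 0
      · right
        refine ⟨hz1, ?_⟩
        rw [hs0, zero_smul] at e1
        exact sub_eq_zero.mp e1.symm
      · left
        refine ⟨hz1, ?_, s, by rw [e1]; abel⟩
        have : s • v ∈ TBT V (fstProj z) := by rw [e2]; exact hz2
        exact ((TBT V (fstProj z)).smul_mem_iff hs0).mp this
    · have : (c (fstProj z) - a) k0 / (c p - a) k0 = s := by
        rw [← e1, Pi.smul_apply, smul_eq_mul, mul_div_cancel_right₀ _ hk0]
      dsimp only
      rw [this, e2, ← hmem]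
  obtain ⟨W', hW, hWr, hWf⟩ := tb_H (k := varDim V + varDim V) (tangentBundle V) (tb_adT hV hs) f
    (n - varDim V - 1) _ hfin (by
      rw [finrank_span_singleton hq0, Fintype.card_sum, Fintype.card_fin, Fintype.card_fin]
      omega)
  rw [Fintype.card_sum, Fintype.card_fin, Fintype.card_fin] at hWr
  let Λ : (Fin (n + n) → K) →ₗ[K] (Fin (varDim V) ⊕ Fin n → K) :=
    { toFun := fun z => Sum.elim (c (fstProj z)) (sndProj z)
      map_add' := by
        intro x y
        have : fstProj (x + y) = fstProj x + fstProj y := rfl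
        rw [this, map_add]
        ext i
        rcases i with i | i <;> rfl
      map_smul' := by
        intro t x
        have : fstProj (t • x) = t • fstProj x := rfl
        rw [this, map_smul]
        ext i
        rcases i with i | i <;> rfl }
  have hΛ : ∀ z, Λ z = Sum.elim (c (fstProj z)) (sndProj z) := fun z => rfl
  have hΛs : Function.Surjective Λ := by
    intro q
    obtain ⟨x, hx⟩ := hc (fun i => q (Sum.inl i))
    refine ⟨Fin.append x (fun i => q (Sum.inr i)), ?_⟩
    rw [hΛ, hfst, hsnd, hx]
    ext i
    rcases i with i | i <;> rfl
  have hrank : Module.finrank K (W'.comap Λ) = (n + n) - varDim (tangentBundle V) := by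
    have hk : W'.comap Λ = LinearMap.ker (W'.mkQ.comp Λ) := by
      rw [LinearMap.ker_comp, Submodule.ker_mkQ]
    have hr : LinearMap.range (W'.mkQ.comp Λ) = ⊤ :=
      LinearMap.range_eq_top.mpr ((Submodule.mkQ_surjective _).comp hΛs)
    have e1 := LinearMap.finrank_range_add_finrank_ker (W'.mkQ.comp Λ)
    rw [hr, finrank_top, ← hk] at e1
    have e2 := Submodule.finrank_quotient_add_finrank W'
    rw [hWr] at e2
    simp only [Module.finrank_fintype_fun_eq_card, Fintype.card_sum, Fintype.card_fin] at e1 e2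
    rw [tb_dimT hV hs]
    omega
  let M : AffineSubspace K (Fin (n + n) → K) := AffineSubspace.mk' (Fin.append p1 0) (W'.comap Λ)
  have hM : ∀ z, z ∈ M ↔ (fun i => eval z (f i)) ∈ W' := by
    intro z
    rw [AffineSubspace.mem_mk', vsub_eq_sub, Submodule.mem_comap, map_sub, hf, hΛ, hΛ, hfst, hsnd,
      hcp1]
    have : Sum.elim (c (fstProj z)) (sndProj z) - Sum.elim a (0 : Fin n → K) =
        Sum.elim (c (fstProj z) - a) (sndProj z) := by
      ext i
      rcases i with i | i <;> simp
    rw [this]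
  have hMfin : (tangentBundle V ∩ (M : Set (Fin (n + n) → K))).Finite := by
    refine hWf.subset ?_
    rintro z ⟨hz, hzM⟩
    exact ⟨hz, (hM z).mp hzM⟩
  have hbig : geomDegree V + 1 ≤ (tangentBundle V ∩ (M : Set (Fin (n + n) → K))).ncard := by
    have hinj : Function.Injective (fun x : Fin n → K => Fin.append x (0 : Fin n → K)) := by
      intro x y h
      have := congrArg fstProj h
      simpa [hfst] using this
    have hni : Fin.append p v ∉ (fun x : Fin n → K => Fin.append x (0 : Fin n → K)) ''
        {x ∈ V | c x = a} := by
      rintro ⟨x, -, hx⟩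
      have := congrArg sndProj hx
      simp only [hsnd] at this
      exact hv0 this.symm
    rw [← hQc, ← Set.ncard_image_of_injective {x ∈ V | c x = a} hinj,
      ← Set.ncard_insert_of_notMem hni (hQf.image _)]
    apply Set.ncard_le_ncard _ hMfin
    rintro z (rfl | ⟨x, ⟨hx, hxa⟩, rfl⟩)
    · refine ⟨⟨by rwa [hfst], by rw [hfst, hsnd]; exact hv⟩, (hM _).mpr ?_⟩
      rw [hf, hfst, hsnd]
      exact hW (Submodule.mem_span_singleton_self _)
    · refine ⟨⟨by rwa [hfst], by rw [hfst, hsnd]; exact (TBT V x).zero_mem⟩, (hM _).mpr ?_⟩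
      rw [hf, hfst, hsnd, hxa, sub_self]
      have : (Sum.elim 0 0 : Fin (varDim V) ⊕ Fin n → K) = 0 := by
        ext i
        rcases i with i | i <;> rfl
      rw [this]
      exact W'.zero_mem
  have hmemset : (tangentBundle V ∩ (M : Set (Fin (n + n) → K))).ncard ∈
      {m | ∃ L : AffineSubspace K (Fin (n + n) → K),
        Module.finrank K L.direction = (n + n) - varDim (tangentBundle V) ∧
        (tangentBundle V ∩ (L : Set (Fin (n + n) → K))).Finite ∧
        (tangentBundle V ∩ (L : Set (Fin (n + n) → K))).ncard = m} :=
    ⟨M, by rw [AffineSubspace.direction_mk', hrank], hMfin, rfl⟩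
  intro heq
  by_cases hb : BddAbove {m | ∃ L : AffineSubspace K (Fin (n + n) → K),
        Module.finrank K L.direction = (n + n) - varDim (tangentBundle V) ∧
        (tangentBundle V ∩ (L : Set (Fin (n + n) → K))).Finite ∧
        (tangentBundle V ∩ (L : Set (Fin (n + n) → K))).ncard = m}
  · have := le_csSup hb hmemset
    rw [← geomDegree, heq] at this
    omega
  · have := Nat.sSup_of_not_bddAbove hb
    rw [← geomDegree, heq] at this
    omega


lemma tb_aff_deg {K : Type} [Field K] [Infinite K] {n : ℕ} (W : AffineSubspace K (Fin n → K))
    (hne : (W : Set (Fin n → K)).Nonempty)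
    (hd : Module.finrank K W.direction = varDim (W : Set (Fin n → K))) :
    geomDegree (W : Set (Fin n → K)) = 1 := by
  obtain ⟨x0, hx0⟩ := hne
  have hle : ∀ m ∈ {m | ∃ L : AffineSubspace K (Fin n → K),
    Module.finrank K L.direction = n - varDim (W : Set (Fin n → K)) ∧
    ((W : Set (Fin n → K)) ∩ (L : Set (Fin n → K))).Finite ∧
    ((W : Set (Fin n → K)) ∩ (L : Set (Fin n → K))).ncard = m}, m ≤ 1 := by
    rintro m ⟨L, -, hfin, rfl⟩
    rw [Set.ncard_le_one hfin]
    rintro x ⟨hx1, hx2⟩ y ⟨hy1, hy2⟩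
    by_contra hxy
    refine (Set.infinite_of_injective_forall_mem (f := fun t : K => AffineMap.lineMap (k := K) x y t)
      (AffineMap.lineMap_injective K hxy) fun t => ?_) hfin
    exact ⟨AffineMap.lineMap_mem t hx1 hy1, AffineMap.lineMap_mem t hx2 hy2⟩
  apply le_antisymm
  · exact csSup_le' hle
  · refine le_csSup ⟨1, hle⟩ ?_
    obtain ⟨D, hD⟩ := Submodule.exists_isCompl W.direction
    have hset : (W : Set (Fin n → K)) ∩ (AffineSubspace.mk' x0 D : Set (Fin n → K)) = {x0} := by
      ext x
      rw [Set.mem_inter_iff, SetLike.mem_coe, SetLike.mem_coe, AffineSubspace.mem_mk',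
        Set.mem_singleton_iff]
      constructor
      · rintro ⟨h1, h2⟩
        have h3 := AffineSubspace.vsub_mem_direction h1 hx0
        have := Submodule.disjoint_def.mp hD.disjoint _ h3 h2
        exact vsub_eq_zero_iff_eq.mp this
      · rintro rfl
        exact ⟨hx0, by simp⟩
    refine ⟨AffineSubspace.mk' x0 D, ?_, ?_, ?_⟩
    · rw [AffineSubspace.direction_mk', ← hd]
      have := Submodule.finrank_add_eq_of_isCompl hD
      simp only [Module.finrank_fintype_fun_eq_card, Fintype.card_fin] at this
      omega
    · rw [hset]; exact Set.finite_singleton _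
    · rw [hset]; exact Set.ncard_singleton _

lemma tb_aff_T {K : Type} [Field K] [Infinite K] {n : ℕ} (L : AffineSubspace K (Fin n → K))
    (p : Fin n → K) (hp : p ∈ L) : TBT (L : Set (Fin n → K)) p = L.direction := by
  apply le_antisymm
  · intro v hv
    by_contra hcon
    obtain ⟨ω, hω1, hω2⟩ := Submodule.exists_dual_map_eq_bot_of_notMem hcon inferInstance
    obtain ⟨F, hF⟩ := tb_linpoly (LinearMap.pi fun _ : Unit => ω)
    have hφ : F () - C (ω p) ∈ vanishingIdeal K (L : Set (Fin n → K)) := by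
      rw [tb_mem_van]
      intro x hx
      have h1 : ω (x - p) = 0 := by
        rw [← Submodule.mem_bot K, ← hω2]
        exact Submodule.mem_map_of_mem (AffineSubspace.vsub_mem_direction hx hp)
      rw [map_sub] at h1
      simpa [hF] using h1
    have h2 := hv _ hφ
    rw [← tb_dir_eval] at h2
    have h3 := tb_dir_line v p (F () - C (ω p))
    have h4 : (aeval (fun i => Polynomial.C (p i) + Polynomial.C (v i) * Polynomial.X)
        (F () - C (ω p)) : Polynomial K) = Polynomial.C (ω v) * Polynomial.X := by
      apply Polynomial.funext
      intro t
      rw [tb_line_eval]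
      have : (fun i => p i + v i * t) = p + t • v := by ext i; simp [mul_comm]
      rw [this]
      rw [map_sub, hF, eval_C, LinearMap.pi_apply, map_add, map_smul, smul_eq_mul,
        Polynomial.eval_mul, Polynomial.eval_C, Polynomial.eval_X]
      ring
    rw [h4] at h3
    have h5 := congrArg (Polynomial.eval 0) h3
    rw [tb_line_eval] at h5
    simp at h5
    exact hω1 (h5.trans h2)
  · intro v hv φ hφ
    rw [← tb_dir_eval]
    have h3 := tb_dir_line v p φ
    have h4 : (aeval (fun i => Polynomial.C (p i) + Polynomial.C (v i) * Polynomial.X)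
        φ : Polynomial K) = 0 := by
      apply Polynomial.funext
      intro t
      rw [tb_line_eval, Polynomial.eval_zero]
      apply tb_mem_van.mp hφ
      have : (fun i => p i + v i * t) = t • v +ᵥ p := by
        ext i; simp [mul_comm, add_comm]
      rw [this]
      exact AffineSubspace.vadd_mem_of_mem_direction (L.direction.smul_mem t hv) hp
    rw [h4, Polynomial.derivative_zero] at h3
    have h5 := congrArg (Polynomial.eval 0) h3
    rw [tb_line_eval] at h5
    simpa using h5.symm

lemma tb_lin {K : Type} [Field K] [IsAlgClosed K] [CharZero K] {n : ℕ} {V : Set (Fin n → K)}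
    (hV : IsIrreducibleVariety V) (hs : IsSmoothVariety V) (hl : IsLinearVariety V) :
    geomDegree (tangentBundle V) = geomDegree V := by
  obtain ⟨L, rfl⟩ := hl
  have hinf : Infinite K := inferInstance
  obtain ⟨p, hp⟩ := tb_nonempty hV
  have hd : Module.finrank K L.direction = varDim (L : Set (Fin n → K)) := by
    rw [← tb_finrankT hs p hp, tb_aff_T L p hp]
  obtain ⟨e, he⟩ : ∃ e : (Fin (n + n) → K) ≃ₗ[K] (Fin n → K) × (Fin n → K),
      ∀ z, e z = (fstProj z, sndProj z) :=
    ⟨(LinearEquiv.funCongrLeft K K finSumFinEquiv).trans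
      (LinearEquiv.sumArrowLequivProdArrow _ _ K K), fun z => by
        ext i <;> simp [fstProj, sndProj, LinearEquiv.funCongrLeft, LinearMap.funLeft]⟩
  let D : Submodule K (Fin (n + n) → K) :=
    (L.direction.prod L.direction).comap (e : (Fin (n + n) → K) →ₗ[K] _)
  have hT : tangentBundle (L : Set (Fin n → K)) =
      (AffineSubspace.mk' (e.symm (p, 0)) D : Set (Fin (n + n) → K)) := by
    ext z
    rw [SetLike.mem_coe, AffineSubspace.mem_mk', vsub_eq_sub, Submodule.mem_comap,
      LinearEquiv.coe_coe, map_sub, LinearEquiv.apply_symm_apply, he, Submodule.mem_prod]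
    simp only [Prod.mk_sub_mk, sub_zero]
    constructor
    · rintro ⟨h1, h2⟩
      refine ⟨AffineSubspace.vsub_mem_direction h1 hp, ?_⟩
      rw [← tb_aff_T L _ h1]
      exact h2
    · rintro ⟨h1, h2⟩
      have h3 : fstProj z ∈ L := by
        have := AffineSubspace.vadd_mem_of_mem_direction h1 hp
        simpa using this
      refine ⟨h3, ?_⟩
      rw [← tb_aff_T L _ h3] at h2
      exact h2
  have hDr : Module.finrank K D = varDim (L : Set (Fin n → K)) + varDim (L : Set (Fin n → K)) := by
    have h1 : D = (L.direction.prod L.direction).map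
        (e.symm : _ →ₗ[K] (Fin (n + n) → K)) := by
      ext z
      simp [D, Submodule.mem_map_equiv]
    have h3 : L.direction.prod L.direction =
        LinearMap.range (L.direction.subtype.prodMap L.direction.subtype) := by
      rw [LinearMap.range_prodMap, Submodule.range_subtype]
    rw [h1, LinearEquiv.finrank_map_eq, h3, LinearMap.finrank_range_of_inj, Module.finrank_prod, hd]
    rintro ⟨a, b⟩ ⟨a', b'⟩ h
    simp only [LinearMap.prodMap_apply, Prod.mk.injEq, Submodule.subtype_apply,
      Subtype.coe_inj] at h
    rw [h.1, h.2]
  have h2 := tb_dimT hV hs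
  rw [tb_aff_deg L ⟨p, hp⟩ hd]
  rw [hT] at h2 ⊢
  apply tb_aff_deg
  · exact ⟨_, AffineSubspace.self_mem_mk' _ _⟩
  · rw [AffineSubspace.direction_mk', hDr, h2]

/-- A smooth irreducible algebraic variety `V ⊆ A^n` satisfies `deg(TV) = deg(V)`
if and only if `V` is a linear variety. -/
theorem degree_tangentBundle_eq_iff_linear {K : Type} [Field K] [IsAlgClosed K] [CharZero K]
    {n : ℕ} (V : Set (Fin n → K)) (h1 : IsIrreducibleVariety V)
    (h2 : IsSmoothVariety V) :
    geomDegree (tangentBundle V) = geomDegree V ↔ IsLinearVariety V := by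
  refine ⟨fun h => ?_, tb_lin h1 h2⟩
  by_contra hl
  exact tb_nonlin h1 h2 hl h
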